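/- arXiv:1703.10244 — 6 statements merged into one kernel-verified Lean document; each statement's English description precedes it below -/
import Mathlib

section
/- There exist absolute constants c, C > 0 such that for every symmetric convex body A in ℝⁿ and every q with 0 < q < c/β_*(A): w(A)/w_{−q}(A) ≤ E[h_A(Z)]/(E[h_A(Z)^{−q}])^{−1/q} ≤ exp(C·max{√(β_*(A)), q·β_*(A)}), where Z ~ γ_n and w_{−q}(A) := (∫_{S^{n−1}} h_A(θ)^{−q} dσ(θ))^{−1/q}. -/
open MeasureTheory ProbabilityTheory Real Set
open scoped RealInnerProductSpace

/-- The standard Gaussian probability measure `γ_n` on `ℝⁿ`. -/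
noncomputable def stdGaussian (n : ℕ) : Measure (EuclideanSpace ℝ (Fin n)) :=
  (Measure.pi fun _ : Fin n => gaussianReal 0 1).map (EuclideanSpace.equiv (Fin n) ℝ).symm

/-- The rotation-invariant (uniform) probability measure `σ` on the Euclidean unit sphere
`S^{n−1}`, viewed as a measure on `ℝⁿ` supported on the sphere. -/
noncomputable def uniformSphere (n : ℕ) : Measure (EuclideanSpace ℝ (Fin n)) :=
  (((volume : Measure (EuclideanSpace ℝ (Fin n))).toSphere Set.univ)⁻¹ •
    (volume : Measure (EuclideanSpace ℝ (Fin n))).toSphere).map Subtype.val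

/-- The support function `h_A(x) = max_{a ∈ A} ⟨a, x⟩`. -/
noncomputable def suppFn {n : ℕ} (A : Set (EuclideanSpace ℝ (Fin n)))
    (x : EuclideanSpace ℝ (Fin n)) : ℝ :=
  sSup ((fun a => ⟪a, x⟫) '' A)

/-- The mean width `w(A) = ∫_{S^{n−1}} h_A(θ) dσ(θ)`. -/
noncomputable def meanWidth {n : ℕ} (A : Set (EuclideanSpace ℝ (Fin n))) : ℝ :=
  ∫ θ, suppFn A θ ∂uniformSphere n

/-- The negative-moment mean width `w_{−q}(A) = (∫_{S^{n−1}} h_A(θ)^{−q} dσ(θ))^{−1/q}`. -/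
noncomputable def meanWidthNeg {n : ℕ} (q : ℝ) (A : Set (EuclideanSpace ℝ (Fin n))) : ℝ :=
  (∫ θ, suppFn A θ ^ (-q) ∂uniformSphere n) ^ (-(1 : ℝ) / q)

/-- `β_*(A) = Var[h_A(Z)]/(E[h_A(Z)])²`, `Z ~ γ_n`. -/
noncomputable def betaStar {n : ℕ} (A : Set (EuclideanSpace ℝ (Fin n))) : ℝ :=
  variance (suppFn A) (stdGaussian n) / (∫ x, suppFn A x ∂stdGaussian n) ^ 2

namespace SNM

set_option linter.unusedSectionVars false

variable {E : Type*} [NormedAddCommGroup E] [InnerProductSpace ℝ E] [FiniteDimensional ℝ E]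
  [MeasurableSpace E] [BorelSpace E]

/-- Standard Gaussian measure on a Euclidean space. -/
noncomputable abbrev G (E : Type*) [NormedAddCommGroup E] [InnerProductSpace ℝ E]
    [FiniteDimensional ℝ E] [MeasurableSpace E] [BorelSpace E] : Measure E :=
  ProbabilityTheory.stdGaussian E

/-- Gaussian density. -/
noncomputable def rho (E : Type*) [NormedAddCommGroup E] [InnerProductSpace ℝ E] (x : E) : ℝ :=
  (2 * π) ^ (-(Module.finrank ℝ E / 2 : ℝ)) * Real.exp (-(1/2) * ‖x‖ ^ 2)

lemma rho_pos (x : E) : 0 < rho E x := by unfold rho; positivity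

lemma rho_cont : Continuous (rho E) := by unfold rho; fun_prop

lemma G_density : G E = (volume : Measure E).withDensity (fun x => ENNReal.ofReal (rho E x)) := by
  have hint : Integrable (fun x : E => Real.exp (-(1/2) * ‖x‖ ^ 2)) := by
    have := GaussianFourier.integrable_cexp_neg_mul_sq_norm_add (V := E) (b := (1/2 : ℝ))
      (by norm_num) 0 0
    have h2 := this.re
    refine h2.congr (Filter.Eventually.of_forall fun x => ?_)
    simp only [zero_mul, add_zero]
    have : (-((1/2 : ℝ) : ℂ) * (‖x‖ : ℂ) ^ 2) = ((-(1/2) * ‖x‖ ^ 2 : ℝ) : ℂ) := by push_cast; ring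
    rw [this, ← Complex.ofReal_exp]
    exact Complex.ofReal_re _
  have hrint : Integrable (rho E) := hint.const_mul _
  have hfin : IsFiniteMeasure ((volume : Measure E).withDensity
      (fun x => ENNReal.ofReal (rho E x))) :=
    isFiniteMeasure_withDensity_ofReal hrint.2
  apply Measure.ext_of_charFun
  ext t
  rw [charFun_stdGaussian, charFun_apply, integral_withDensity_eq_integral_toReal_smul
    (by have := rho_cont (E := E); fun_prop) (by simp)]
  have h := GaussianFourier.integral_cexp_neg_mul_sq_norm_add (V := E) (b := (1/2 : ℝ))
      (by norm_num) Complex.I t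
  have h3 : ∀ x : E, (ENNReal.ofReal (rho E x)).toReal • Complex.exp (⟪x, t⟫ * Complex.I)
      = ((2 * π) ^ (-(Module.finrank ℝ E / 2 : ℝ)) : ℝ) *
        Complex.exp (-((1/2 : ℝ) : ℂ) * (‖x‖ : ℂ) ^ 2 + Complex.I * ⟪t, x⟫) := by
    intro x
    rw [ENNReal.toReal_ofReal (rho_pos x).le, Complex.real_smul, rho, Complex.exp_add,
      real_inner_comm]
    push_cast
    ring_nf
  simp_rw [h3]
  rw [integral_const_mul, h]
  have h4 : ((π : ℂ) / ((1/2 : ℝ) : ℂ)) ^ ((Module.finrank ℝ E : ℂ) / 2)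
      = (((2 * π) ^ ((Module.finrank ℝ E / 2 : ℝ)) : ℝ) : ℂ) := by
    rw [Complex.ofReal_cpow (by positivity)]
    congr 1
    · push_cast; ring
    · push_cast; ring
  rw [h4, ← mul_assoc, ← Complex.ofReal_mul, ← Real.rpow_add (by positivity)]
  simp
  congr 1
  ring

lemma integral_G (f : E → ℝ) : ∫ x, f x ∂(G E) = ∫ x, rho E x * f x := by
  rw [G_density, integral_withDensity_eq_integral_toReal_smul
    (by have := rho_cont (E := E); fun_prop) (by simp)]
  congr 1
  ext x
  rw [ENNReal.toReal_ofReal (rho_pos x).le, smul_eq_mul]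

/-- Cameron–Martin. -/
lemma integral_shift (f : E → ℝ) (v : E) :
    ∫ x, f (x + v) ∂(G E) = ∫ x, f x * Real.exp (⟪v, x⟫ - ‖v‖ ^ 2 / 2) ∂(G E) := by
  rw [integral_G, integral_G]
  rw [← integral_sub_right_eq_self _ v]
  congr 1
  ext x
  have : rho E (x - v) = rho E x * Real.exp (⟪v, x⟫ - ‖v‖ ^ 2 / 2) := by
    unfold rho
    rw [mul_assoc, ← Real.exp_add]
    congr 2
    rw [norm_sub_sq_real, real_inner_comm]
    ring
  rw [this, sub_add_cancel]
  ring

lemma integrable_exp_norm (L : ℝ) : Integrable (fun x : E => Real.exp (L * ‖x‖)) (G E) := by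
  obtain ⟨C, hC, h⟩ := IsGaussian.exists_integrable_exp_sq (G E)
  refine (h.const_mul (Real.exp (L ^ 2 / (4 * C)))).mono' (by fun_prop) ?_
  refine Filter.Eventually.of_forall fun x => ?_
  rw [Real.norm_eq_abs, abs_of_pos (Real.exp_pos _), ← Real.exp_add]
  apply Real.exp_le_exp.2
  have : 0 ≤ C * (‖x‖ - L / (2 * C)) ^ 2 := by positivity
  have h2 : C * (‖x‖ - L / (2 * C)) ^ 2 = C * ‖x‖ ^ 2 - L * ‖x‖ + L ^ 2 / (4 * C) := by
    field_simp; ring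
  linarith

lemma integrable_of_growth {f : E → ℝ} (hf : Continuous f) (C L : ℝ)
    (h : ∀ x, |f x| ≤ C * Real.exp (L * ‖x‖)) : Integrable f (G E) :=
  ((integrable_exp_norm L).const_mul C).mono' hf.aestronglyMeasurable
    (Filter.Eventually.of_forall h)

/-- Rotation invariance. -/
lemma map_rot (c s : ℝ) (h : c ^ 2 + s ^ 2 = 1) :
    ((G E).prod (G E)).map (fun p : E × E => (c • p.1 + s • p.2, (-s) • p.1 + c • p.2))
      = (G E).prod (G E) := by
  obtain ⟨θ, hc, hs⟩ : ∃ θ, c = Real.cos θ ∧ s = Real.sin θ := by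
    have hz : ‖(⟨c, s⟩ : ℂ)‖ = 1 := by
      rw [Complex.norm_def, Complex.normSq_mk]
      rw [show c * c + s * s = 1 by nlinarith]; simp
    refine ⟨Complex.arg ⟨c, s⟩, ?_, ?_⟩
    · rw [Complex.cos_arg (by intro h0; rw [h0] at hz; simp at hz), hz]; simp
    · rw [Complex.sin_arg, hz]; simp
  have := IsGaussian.map_rotation_eq_self (μ := G E)
    (by simp) θ
  rw [hc, hs]
  exact this

lemma measurePreserving_rot (c s : ℝ) (h : c ^ 2 + s ^ 2 = 1) :
    MeasurePreserving (fun p : E × E => (c • p.1 + s • p.2, (-s) • p.1 + c • p.2))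
      ((G E).prod (G E)) ((G E).prod (G E)) :=
  ⟨by fun_prop, map_rot c s h⟩

end SNM

namespace SNM

set_option linter.unusedSectionVars false

variable {E : Type*} [NormedAddCommGroup E] [InnerProductSpace ℝ E] [FiniteDimensional ℝ E]
  [MeasurableSpace E] [BorelSpace E]

/-- Lipschitz functions (real constant). -/
def Lip (L : ℝ) (f : E → ℝ) : Prop := ∀ x y, |f x - f y| ≤ L * ‖x - y‖

lemma Lip.cont {L : ℝ} {f : E → ℝ} (h : Lip L f) : Continuous f := by
  have : LipschitzWith (Real.toNNReal L) f := by
    apply LipschitzWith.of_dist_le_mul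
    intro x y
    rw [Real.dist_eq, dist_eq_norm]
    refine (h x y).trans ?_
    gcongr
    exact Real.le_coe_toNNReal L
  exact this.continuous

lemma Lip.neg {L : ℝ} {f : E → ℝ} (h : Lip L f) : Lip L (fun x => - f x) := by
  intro x y
  have := h y x
  rw [norm_sub_rev] at this
  rw [show - f x - - f y = f y - f x by ring]
  exact this

lemma Lip.growth {L : ℝ} {f : E → ℝ} (h : Lip L f) (x : E) (r : ℝ) (g : E) :
    |f (x + r • g) - f x| ≤ L * |r| * ‖g‖ := by
  have := h (x + r • g) x
  rwa [add_sub_cancel_left, norm_smul, Real.norm_eq_abs, ← mul_assoc] at this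

lemma le_exp_self (x : ℝ) : x ≤ Real.exp x := by linarith [Real.add_one_le_exp x]

lemma Lip.int_exp {L : ℝ} {f : E → ℝ} (h : Lip L f) (x : E) (r : ℝ) :
    Integrable (fun g => Real.exp (f (x + r • g))) (G E) := by
  have hc := h.cont
  refine integrable_of_growth (by fun_prop) (Real.exp (f x)) (L * |r|) fun g => ?_
  rw [abs_of_pos (Real.exp_pos _), ← Real.exp_add]
  apply Real.exp_le_exp.2
  have := abs_le.1 (h.growth x r g)
  linarith [this.2]

lemma Lip.int {L : ℝ} {f : E → ℝ} (h : Lip L f) (x : E) (r : ℝ) :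
    Integrable (fun g => f (x + r • g)) (G E) := by
  have hc := h.cont
  refine integrable_of_growth (by fun_prop) (Real.exp |f x|) (L * |r|) fun g => ?_
  rw [← Real.exp_add]
  refine le_trans ?_ (le_exp_self _)
  have := h.growth x r g
  have h2 := abs_sub_abs_le_abs_sub (f (x + r • g)) (f x)
  linarith

lemma int_inner (v : E) : Integrable (fun g : E => ⟪v, g⟫) (G E) := by
  refine integrable_of_growth (by fun_prop) 1 ‖v‖ fun g => ?_
  rw [one_mul]
  exact (abs_real_inner_le_norm v g).trans (le_exp_self _)

lemma integral_inner_G (v : E) : ∫ g, ⟪v, g⟫ ∂(G E) = 0 := by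
  have := integral_strongDual_stdGaussian (E := E) (innerSL ℝ v)
  simpa using this

/-- Log-Laplace semigroup. -/
noncomputable def LS (r : ℝ) (F : E → ℝ) (x : E) : ℝ :=
  Real.log (∫ g, Real.exp (F (x + r • g)) ∂(G E))

/-- heat semigroup. -/
noncomputable def PS (r : ℝ) (F : E → ℝ) (x : E) : ℝ := ∫ g, F (x + r • g) ∂(G E)

lemma Lip.pos_exp {L : ℝ} {f : E → ℝ} (h : Lip L f) (x : E) (r : ℝ) :
    0 < ∫ g, Real.exp (f (x + r • g)) ∂(G E) := integral_exp_pos (h.int_exp x r)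

lemma Lip.exp_LS {L : ℝ} {f : E → ℝ} (h : Lip L f) (x : E) (r : ℝ) :
    Real.exp (LS r f x) = ∫ g, Real.exp (f (x + r • g)) ∂(G E) := Real.exp_log (h.pos_exp x r)

lemma Lip.LS {L : ℝ} {f : E → ℝ} (h : Lip L f) (r : ℝ) : Lip L (LS r f) := by
  have key : ∀ x y, SNM.LS r f x ≤ SNM.LS r f y + L * ‖x - y‖ := by
    intro x y
    rw [← Real.exp_le_exp, Real.exp_add, h.exp_LS, h.exp_LS, ← integral_mul_const]
    refine integral_mono (h.int_exp x r) ((h.int_exp y r).mul_const _) fun g => ?_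
    simp only
    rw [← Real.exp_add]
    apply Real.exp_le_exp.2
    have := abs_le.1 (h (x + r • g) (y + r • g))
    rw [add_sub_add_right_eq_sub] at this
    linarith [this.2]
  intro x y
  rw [abs_le]
  have h1 := key x y
  have h2 := key y x
  rw [norm_sub_rev] at h2
  constructor <;> linarith

lemma Lip.PS {L : ℝ} {f : E → ℝ} (h : Lip L f) (r : ℝ) : Lip L (PS r f) := by
  have key : ∀ x y, SNM.PS r f x ≤ SNM.PS r f y + L * ‖x - y‖ := by
    intro x y
    unfold SNM.PS
    have : SNM.PS r f y + L * ‖x - y‖ = ∫ g, (f (y + r • g) + L * ‖x - y‖) ∂(G E) := by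
      rw [integral_add (h.int y r) (integrable_const _)]; simp [SNM.PS]
    unfold SNM.PS at this
    rw [this]
    refine integral_mono (h.int x r) ((h.int y r).add (integrable_const _)) fun g => ?_
    have := abs_le.1 (h (x + r • g) (y + r • g))
    rw [add_sub_add_right_eq_sub] at this
    simp only
    linarith [this.2]
  intro x y
  rw [abs_le]
  have h1 := key x y
  have h2 := key y x
  rw [norm_sub_rev] at h2
  constructor <;> linarith

lemma semigroup_aux {φ : E → ℝ} (x : E) {δ r R : ℝ} (hR : 0 < R) (h : R ^ 2 = δ ^ 2 + r ^ 2)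
    (hi : Integrable (fun g => φ (x + R • g)) (G E)) :
    ∫ g, ∫ g', φ (x + δ • g + r • g') ∂(G E) ∂(G E) = ∫ g, φ (x + R • g) ∂(G E) := by
  have hcs : (δ / R) ^ 2 + (r / R) ^ 2 = 1 := by
    field_simp; linarith
  have mp := measurePreserving_rot (E := E) (δ / R) (r / R) hcs
  have mp1 := (measurePreserving_fst (μ := G E) (ν := G E)).comp mp
  have e : ∀ p : E × E, x + δ • p.1 + r • p.2 = x + R • ((δ / R) • p.1 + (r / R) • p.2) := by
    intro p
    rw [smul_add, smul_smul, smul_smul, mul_div_cancel₀ _ hR.ne', mul_div_cancel₀ _ hR.ne', add_assoc]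
  have hi2 : Integrable (fun p : E × E => φ (x + δ • p.1 + r • p.2)) ((G E).prod (G E)) := by
    have := mp1.integrable_comp_of_integrable hi
    refine this.congr (Filter.Eventually.of_forall fun p => ?_)
    simp [e p]
  have h1 := integral_prod _ hi2
  simp only at h1
  rw [← h1]
  have h2 : ∫ g, φ (x + R • g) ∂(G E) =
      ∫ p, φ (x + R • ((δ / R) • p.1 + (r / R) • p.2)) ∂((G E).prod (G E)) := by
    have hm := mp1.map_eq
    conv_lhs => rw [← hm]
    rw [integral_map mp1.measurable.aemeasurable (by rw [hm]; exact hi.1)]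
    rfl
  rw [h2]
  simp_rw [e]

lemma Lip.LS_LS {L : ℝ} {f : E → ℝ} (h : Lip L f) {δ r R : ℝ} (hR : 0 < R)
    (hh : R ^ 2 = δ ^ 2 + r ^ 2) : SNM.LS δ (SNM.LS r f) = SNM.LS R f := by
  ext x
  unfold SNM.LS
  have := semigroup_aux (φ := fun y => Real.exp (f y)) x hR hh (h.int_exp x R)
  rw [← this]
  congr 2
  ext g
  exact h.exp_LS _ _

lemma Lip.PS_PS {L : ℝ} {f : E → ℝ} (h : Lip L f) {δ r R : ℝ} (hR : 0 < R)
    (hh : R ^ 2 = δ ^ 2 + r ^ 2) : SNM.PS δ (SNM.PS r f) = SNM.PS R f := by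
  ext x
  exact semigroup_aux (φ := f) x hR hh (h.int x R)

lemma isub {Ω : Type*} [MeasurableSpace Ω] {μ : Measure Ω} {f g : Ω → ℝ} (hf : Integrable f μ)
    (hg : Integrable g μ) : Integrable (fun x => f x - g x) μ := hf.sub hg

lemma iadd {Ω : Type*} [MeasurableSpace Ω] {μ : Measure Ω} {f g : Ω → ℝ} (hf : Integrable f μ)
    (hg : Integrable g μ) : Integrable (fun x => f x + g x) μ := hf.add hg

lemma ineg {Ω : Type*} [MeasurableSpace Ω] {μ : Measure Ω} {f : Ω → ℝ} (hf : Integrable f μ) :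
    Integrable (fun x => - f x) μ := hf.neg

lemma jensen_log {Ω : Type*} [MeasurableSpace Ω] {μ : Measure Ω} [IsProbabilityMeasure μ]
    {φ : Ω → ℝ} (h1 : Integrable φ μ)
    (h2 : Integrable (fun x => Real.exp (φ x)) μ) :
    ∫ x, φ x ∂μ ≤ Real.log (∫ x, Real.exp (φ x) ∂μ) := by
  rw [Real.le_log_iff_exp_le (integral_exp_pos h2)]
  set m := ∫ x, φ x ∂μ
  have : ∫ x, Real.exp m * (1 + (φ x - m)) ∂μ = Real.exp m := by
    rw [integral_const_mul, integral_add (integrable_const _) (isub h1 (integrable_const _)),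
      integral_sub h1 (integrable_const _)]
    simp [m]
  rw [← this]
  refine integral_mono ((iadd (integrable_const _) (isub h1 (integrable_const _))).const_mul _) h2
    fun x => ?_
  have h3 := Real.add_one_le_exp (φ x - m)
  have h4 : Real.exp (φ x) = Real.exp m * Real.exp (φ x - m) := by rw [← Real.exp_add]; ring_nf
  simp only
  rw [h4]
  have := Real.exp_pos m
  nlinarith

lemma exp_quad (x : ℝ) : Real.exp x ≤ 1 + x + x ^ 2 * Real.exp |x| := by
  have hone : 1 ≤ Real.exp |x| := Real.one_le_exp (abs_nonneg x)
  by_cases h : |x| ≤ 1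
  · have := abs_le.1 (Real.abs_exp_sub_one_sub_id_le h)
    nlinarith [sq_nonneg x]
  · push Not at h
    rcases le_or_gt x 0 with hx | hx
    · have h1 : Real.exp x ≤ 1 := Real.exp_le_one_iff.2 hx
      rw [abs_of_nonpos hx] at h hone ⊢
      nlinarith [sq_nonneg x]
    · rw [abs_of_pos hx] at h hone ⊢
      have h2 : 1 ≤ x ^ 2 := by nlinarith
      have := mul_le_mul_of_nonneg_right h2 (Real.exp_pos x).le
      linarith

/-- Change of variables in `g ↦ g + v`. -/
lemma integral_shift' (f : E → ℝ) (v : E) :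
    ∫ x, f x ∂(G E) = ∫ x, f (x + v) * Real.exp (-⟪v, x⟫ - ‖v‖ ^ 2 / 2) ∂(G E) := by
  have := integral_shift (fun x => f x * Real.exp (-⟪v, x⟫ + ‖v‖ ^ 2 / 2)) v
  have e1 : ∀ x, f x * Real.exp (-⟪v, x⟫ + ‖v‖ ^ 2 / 2) * Real.exp (⟪v, x⟫ - ‖v‖ ^ 2 / 2) = f x := by
    intro x
    rw [mul_assoc, ← Real.exp_add]
    simp
  simp_rw [e1] at this
  rw [← this]
  congr 1
  ext x
  rw [inner_add_right, real_inner_self_eq_norm_sq]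
  congr 2
  ring

/-- error constant. -/
noncomputable def errC (E : Type*) [NormedAddCommGroup E] [InnerProductSpace ℝ E]
    [FiniteDimensional ℝ E] [MeasurableSpace E] [BorelSpace E] (L K : ℝ) : ℝ :=
  ∫ g : E, K ^ 2 * (‖g‖ + L) ^ 4 * Real.exp (2 * L * (‖g‖ + L)) ∂(G E)

lemma errC_int (L K : ℝ) (hL : 0 ≤ L) : Integrable (fun g : E =>
    K ^ 2 * (‖g‖ + L) ^ 4 * Real.exp (2 * L * (‖g‖ + L))) (G E) := by
  refine integrable_of_growth (by fun_prop) (K ^ 2 * Real.exp ((4 + 2 * L) * L)) (4 + 2 * L)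
    fun g => ?_
  rw [abs_of_nonneg (by positivity), mul_assoc (K ^ 2), mul_assoc (K ^ 2), ← Real.exp_add]
  refine mul_le_mul_of_nonneg_left ?_ (by positivity)
  have h1 : (‖g‖ + L) ^ 4 ≤ Real.exp (4 * (‖g‖ + L)) := by
    have := le_exp_self (‖g‖ + L)
    calc (‖g‖ + L) ^ 4 ≤ (Real.exp (‖g‖ + L)) ^ 4 := by gcongr
      _ = _ := by rw [← Real.exp_nat_mul]; norm_num
  calc _ ≤ Real.exp (4 * (‖g‖ + L)) * Real.exp (2 * L * (‖g‖ + L)) := by gcongr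
    _ = _ := by rw [← Real.exp_add]; ring_nf

lemma core_step {L K δ : ℝ} (hL : 0 ≤ L) (hK : 0 ≤ K) (hδ : 0 < δ) (hδ1 : δ ≤ 1) {b : E → ℝ}
    (hb : Lip L b) (y p : E) (hp : ‖p‖ ≤ L)
    (hbp : ∀ w, |b (y + w) - b y - ⟪p, w⟫| ≤ K * ‖w‖ ^ 2) :
    ∫ g, b (y - δ ^ 2 • p + δ • g) ∂(G E) + δ ^ 2 * ‖p‖ ^ 2 / 2
      ≤ - LS δ (fun x => - b x) y + errC E L K * δ ^ 4 := by
  set ρ : E → ℝ := fun g => b (y - δ ^ 2 • p + δ • g) - b y - ⟪p, δ • g - δ ^ 2 • p⟫ with hρ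
  have hc := hb.cont
  have hρc : Continuous ρ := by fun_prop
  have hw : ∀ g : E, ‖δ • g - δ ^ 2 • p‖ ≤ δ * (‖g‖ + L) := by
    intro g
    calc _ ≤ ‖δ • g‖ + ‖δ ^ 2 • p‖ := norm_sub_le _ _
      _ = δ * ‖g‖ + δ ^ 2 * ‖p‖ := by
        rw [norm_smul, norm_smul]; simp [abs_of_pos hδ]
      _ ≤ δ * ‖g‖ + δ * L := by
        have : δ ^ 2 ≤ δ := by nlinarith
        have := mul_le_mul this hp (norm_nonneg _) hδ.le
        linarith
      _ = _ := by ring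
  have e0 : ∀ g : E, y - δ ^ 2 • p + δ • g = y + (δ • g - δ ^ 2 • p) := by intro g; abel
  have hρ1 : ∀ g, |ρ g| ≤ K * δ ^ 2 * (‖g‖ + L) ^ 2 := by
    intro g
    have := hbp (δ • g - δ ^ 2 • p)
    rw [← e0] at this
    refine this.trans ?_
    have h2 : ‖δ • g - δ ^ 2 • p‖ ^ 2 ≤ (δ * (‖g‖ + L)) ^ 2 := by
      gcongr; exact hw g
    nlinarith
  have hρ2 : ∀ g, |ρ g| ≤ 2 * L * (‖g‖ + L) := by
    intro g
    have h1 := hb (y - δ ^ 2 • p + δ • g) y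
    rw [e0, add_sub_cancel_left, ← e0] at h1
    have h2 := abs_real_inner_le_norm p (δ • g - δ ^ 2 • p)
    have h3 := hw g
    have h4 : ‖δ • g - δ ^ 2 • p‖ ≤ ‖g‖ + L := by
      refine h3.trans ?_
      have : 0 ≤ ‖g‖ + L := by positivity
      nlinarith
    have h5 : ‖p‖ * ‖δ • g - δ ^ 2 • p‖ ≤ L * (‖g‖ + L) := by gcongr
    have h6 : L * ‖δ • g - δ ^ 2 • p‖ ≤ L * (‖g‖ + L) := by gcongr
    have := abs_sub (b (y - δ ^ 2 • p + δ • g) - b y) (⟪p, δ • g - δ ^ 2 • p⟫)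
    show |b (y - δ ^ 2 • p + δ • g) - b y - ⟪p, δ • g - δ ^ 2 • p⟫| ≤ _
    linarith
  have hbi : Integrable (fun g => b (y - δ ^ 2 • p + δ • g)) (G E) := hb.int _ _
  have hini : Integrable (fun g => ⟪p, δ • g - δ ^ 2 • p⟫) (G E) := by
    have : (fun g : E => ⟪p, δ • g - δ ^ 2 • p⟫) = fun g => δ * ⟪p, g⟫ - δ ^ 2 * ‖p‖ ^ 2 := by
      ext g; rw [inner_sub_right, inner_smul_right, inner_smul_right, real_inner_self_eq_norm_sq]
    rw [this]
    exact ((int_inner p).const_mul _).sub (integrable_const _)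
  have hρi : Integrable ρ (G E) := isub (isub hbi (integrable_const _)) hini
  have hEρ : ∫ g, ρ g ∂(G E) = ∫ g, b (y - δ ^ 2 • p + δ • g) ∂(G E) - b y + δ ^ 2 * ‖p‖ ^ 2 := by
    simp only [hρ]
    rw [integral_sub (isub hbi (integrable_const _)) hini, integral_sub hbi (integrable_const _)]
    have : (fun g : E => ⟪p, δ • g - δ ^ 2 • p⟫) = fun g => δ * ⟪p, g⟫ - δ ^ 2 * ‖p‖ ^ 2 := by
      ext g; rw [inner_sub_right, inner_smul_right, inner_smul_right, real_inner_self_eq_norm_sq]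
    rw [this, integral_sub ((int_inner p).const_mul _) (integrable_const _), integral_const_mul,
      integral_inner_G]
    simp
  have hexpρ : Integrable (fun g => Real.exp (- ρ g)) (G E) := by
    refine integrable_of_growth (by fun_prop) (Real.exp (2 * L * L)) (2 * L) fun g => ?_
    rw [abs_of_pos (Real.exp_pos _), ← Real.exp_add]
    apply Real.exp_le_exp.2
    have := neg_abs_le (ρ g)
    linarith [hρ2 g]
  have herr : ∫ g, Real.exp (- ρ g) ∂(G E) ≤ 1 - ∫ g, ρ g ∂(G E) + errC E L K * δ ^ 4 := by
    have : 1 - ∫ g, ρ g ∂(G E) + errC E L K * δ ^ 4 = ∫ g, (1 - ρ g +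
      K ^ 2 * (‖g‖ + L) ^ 4 * Real.exp (2 * L * (‖g‖ + L)) * δ ^ 4) ∂(G E) := by
      rw [integral_add (isub (integrable_const _) hρi) ((errC_int L K hL).mul_const _),
        integral_sub (integrable_const _) hρi, integral_mul_const, errC]
      simp
    rw [this]
    refine integral_mono hexpρ (iadd (isub (integrable_const _) hρi)
      ((errC_int L K hL).mul_const _)) fun g => ?_
    simp only
    have h1 := exp_quad (- ρ g)
    rw [abs_neg, neg_sq] at h1
    have h2 : ρ g ^ 2 ≤ K ^ 2 * δ ^ 4 * (‖g‖ + L) ^ 4 := by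
      rw [← sq_abs]
      calc _ ≤ (K * δ ^ 2 * (‖g‖ + L) ^ 2) ^ 2 := by gcongr; exact hρ1 g
        _ = _ := by ring
    have h3 : Real.exp |ρ g| ≤ Real.exp (2 * L * (‖g‖ + L)) := Real.exp_le_exp.2 (hρ2 g)
    have h4 := mul_le_mul h2 h3 (Real.exp_pos _).le (by positivity)
    linarith
  have hLS : LS δ (fun x => - b x) y = - b y + δ ^ 2 * ‖p‖ ^ 2 / 2
      + Real.log (∫ g, Real.exp (- ρ g) ∂(G E)) := by
    unfold LS
    rw [integral_shift' (fun g => Real.exp (- b (y + δ • g))) (-δ • p)]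
    have : ∀ g : E, Real.exp (- b (y + δ • (g + -δ • p))) *
        Real.exp (-⟪-δ • p, g⟫ - ‖-δ • p‖ ^ 2 / 2) =
        Real.exp (- b y + δ ^ 2 * ‖p‖ ^ 2 / 2) * Real.exp (- ρ g) := by
      intro g
      rw [← Real.exp_add, ← Real.exp_add]
      congr 1
      have e1 : y + δ • (g + -δ • p) = y - δ ^ 2 • p + δ • g := by
        rw [smul_add, smul_smul, show δ * -δ = - δ ^ 2 by ring, neg_smul]; abel
      rw [e1]
      simp only [hρ]
      rw [inner_sub_right, inner_smul_right, inner_smul_right, inner_smul_left,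
        real_inner_self_eq_norm_sq, norm_smul, mul_pow]
      simp
      ring
    simp_rw [this]
    rw [integral_const_mul, Real.log_mul (Real.exp_pos _).ne' (integral_exp_pos hexpρ).ne',
      Real.log_exp]
  have hlog := Real.log_le_sub_one_of_pos (integral_exp_pos hexpρ)
  rw [hLS]
  linarith

lemma step {ε L L' K δ κ : ℝ} (hL : 0 ≤ L) (hK : 0 ≤ K) (hδ : 0 < δ) (hδ1 : δ ≤ 1)
    {F a b : E → ℝ} (hF : Lip L' F) (ha : Lip L' a) (hb : Lip L b)
    (hnice : ∀ y, ∃ p : E, ‖p‖ ≤ L ∧ ∀ w, |b (y + w) - b y - ⟪p, w⟫| ≤ K * ‖w‖ ^ 2)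
    (h : ∀ x y, a x - ε ^ 2 * b y - κ ≤ F ((1 - ε) • x + ε • y)) (x y : E) :
    PS δ a x - ε ^ 2 * (- LS δ (fun x => - b x) y) - (κ + ε ^ 2 * errC E L K * δ ^ 4)
      ≤ LS δ F ((1 - ε) • x + ε • y) := by
  obtain ⟨p, hp, hbp⟩ := hnice y
  have hcore := core_step hL hK hδ hδ1 hb y p hp hbp
  set z := (1 - ε) • x + ε • y with hz
  set v : E := (-(ε * δ)) • p with hv
  have hFc := hF.cont
  have i1 : Integrable (fun g => F (z + δ • v + δ • g)) (G E) := hF.int _ _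
  have i2 : Integrable (fun g => -⟪v, g⟫ - ‖v‖ ^ 2 / 2) (G E) :=
    isub (ineg (int_inner v)) (integrable_const _)
  have e1 : ∀ g : E, Real.exp (F (z + δ • (g + v))) * Real.exp (-⟪v, g⟫ - ‖v‖ ^ 2 / 2)
      = Real.exp (F (z + δ • v + δ • g) + (-⟪v, g⟫ - ‖v‖ ^ 2 / 2)) := by
    intro g
    rw [← Real.exp_add, smul_add, add_comm (δ • g), ← add_assoc]
  have i3 : Integrable (fun g => Real.exp (F (z + δ • v + δ • g) + (-⟪v, g⟫ - ‖v‖ ^ 2 / 2)))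
      (G E) := by
    refine integrable_of_growth (by fun_prop) (Real.exp (F (z + δ • v))) (L' * |δ| + ‖v‖)
      fun g => ?_
    rw [abs_of_pos (Real.exp_pos _), ← Real.exp_add]
    apply Real.exp_le_exp.2
    have h1 := (abs_le.1 (hF.growth (z + δ • v) δ g)).2
    have h2 := (abs_le.1 (abs_real_inner_le_norm v g)).1
    have h3 : 0 ≤ ‖v‖ ^ 2 / 2 := by positivity
    linarith
  have hj := jensen_log (iadd i1 i2) i3
  have hLS : LS δ F z = Real.log (∫ g, Real.exp (F (z + δ • v + δ • g) +
      (-⟪v, g⟫ - ‖v‖ ^ 2 / 2)) ∂(G E)) := by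
    unfold LS
    rw [integral_shift' (fun g => Real.exp (F (z + δ • g))) v]
    simp_rw [e1]
  rw [hLS]
  refine le_trans ?_ hj
  have e2 : ∫ g, (F (z + δ • v + δ • g) + (-⟪v, g⟫ - ‖v‖ ^ 2 / 2)) ∂(G E)
      = ∫ g, F (z + δ • v + δ • g) ∂(G E) - ε ^ 2 * δ ^ 2 * ‖p‖ ^ 2 / 2 := by
    rw [integral_add i1 i2, integral_sub (ineg (int_inner v)) (integrable_const _), integral_neg,
      integral_inner_G]
    simp [hv, norm_smul, mul_pow]
    ring
  have e3 : ∫ g, (a (x + δ • g) - ε ^ 2 * b (y - δ ^ 2 • p + δ • g) - κ) ∂(G E)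
      ≤ ∫ g, F (z + δ • v + δ • g) ∂(G E) := by
    refine integral_mono (isub (isub (ha.int _ _) ((hb.int _ _).const_mul _)) (integrable_const _))
      i1 fun g => ?_
    have := h (x + δ • g) (y - δ ^ 2 • p + δ • g)
    refine this.trans (le_of_eq ?_)
    congr 1
    rw [hz, hv]
    module
  rw [integral_sub (isub (ha.int _ _) ((hb.int _ _).const_mul _)) (integrable_const _),
    integral_sub (ha.int _ _) ((hb.int _ _).const_mul _), integral_const_mul] at e3
  simp only [integral_const, probReal_univ, smul_eq_mul, one_mul] at e3
  have h5 := mul_le_mul_of_nonneg_left hcore (sq_nonneg ε)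
  show _ ≤ ∫ g, (F (z + δ • v + δ • g) + (-⟪v, g⟫ - ‖v‖ ^ 2 / 2)) ∂(G E)
  rw [e2]
  unfold PS
  linarith

end SNM

namespace SNM

set_option linter.unusedSectionVars false

variable {E : Type*} [NormedAddCommGroup E] [InnerProductSpace ℝ E] [FiniteDimensional ℝ E]
  [MeasurableSpace E] [BorelSpace E]

/-- `b` has a second order estimate. -/
def Nice (L K : ℝ) (b : E → ℝ) : Prop :=
  ∀ y, ∃ p : E, ‖p‖ ≤ L ∧ ∀ w, |b (y + w) - b y - ⟪p, w⟫| ≤ K * ‖w‖ ^ 2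

lemma Nice.exists_measurable {L K : ℝ} {b : E → ℝ} (h : Nice L K b) :
    ∃ D : E → E, Measurable D ∧ (∀ y, ‖D y‖ ≤ L) ∧
      ∀ y w, |b (y + w) - b y - ⟪D y, w⟫| ≤ K * ‖w‖ ^ 2 := by
  choose D hD1 hD2 using h
  refine ⟨D, ?_, hD1, hD2⟩
  have hder : ∀ y, HasFDerivAt b (innerSL ℝ (D y)) y := by
    intro y
    rw [hasFDerivAt_iff_isLittleO_nhds_zero]
    have h1 : (fun w : E => b (y + w) - b y - (innerSL ℝ (D y)) w) =O[nhds 0]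
        (fun w : E => ‖w‖ ^ 2) := by
      apply Asymptotics.IsBigO.of_bound K
      filter_upwards with w
      have := hD2 y w
      simpa using this
    refine h1.trans_isLittleO ?_
    have := Asymptotics.isLittleO_norm_pow_id (E' := E) (one_lt_two)
    simpa using this
  have : D = fun y => (InnerProductSpace.toDual ℝ E).symm (fderiv ℝ b y) := by
    ext1 y
    rw [(hder y).fderiv]
    apply (InnerProductSpace.toDual ℝ E).injective
    rw [LinearIsometryEquiv.apply_symm_apply]
    rfl
  rw [this]
  exact (InnerProductSpace.toDual ℝ E).symm.continuous.measurable.comp (measurable_fderiv ℝ b)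

lemma hoeff {Ω : Type*} [MeasurableSpace Ω] {ν : Measure Ω} [IsProbabilityMeasure ν]
    {u : Ω → ℝ} (hu : Measurable u) {R : ℝ} (hR : ∀ g, |u g| ≤ R) :
    Real.log (∫ g, Real.exp (- u g) ∂ν) ≤ - ∫ g, u g ∂ν + R ^ 2 / 2 ∧
    - ∫ g, u g ∂ν ≤ Real.log (∫ g, Real.exp (- u g) ∂ν) ∧
    Integrable (fun g => Real.exp (- u g)) ν := by
  have iu : Integrable u ν := Integrable.of_bound hu.aestronglyMeasurable R
    (Filter.Eventually.of_forall fun g => by simpa using hR g)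
  have ie : Integrable (fun g => Real.exp (- u g)) ν :=
    Integrable.of_bound (by fun_prop) (Real.exp R)
    (Filter.Eventually.of_forall fun g => by
      rw [Real.norm_eq_abs, abs_of_pos (Real.exp_pos _)]
      exact Real.exp_le_exp.2 ((neg_le_abs _).trans (hR g)))
  refine ⟨?_, ?_, ie⟩
  · have h := hasSubgaussianMGF_of_mem_Icc (μ := ν) (X := u) (a := -R) (b := R) hu.aemeasurable
      (Filter.Eventually.of_forall fun g => abs_le.1 (hR g))
    have h2 := h.mgf_le (-1)
    unfold mgf at h2
    rw [Real.log_le_iff_le_exp (integral_exp_pos ie)]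
    have e : ∀ g, Real.exp (-1 * (u g - ∫ x, u x ∂ν)) = Real.exp (∫ x, u x ∂ν) * Real.exp (- u g) := by
      intro g; rw [← Real.exp_add]; congr 1; ring
    simp_rw [e] at h2
    rw [integral_const_mul] at h2
    have h3 := mul_le_mul_of_nonneg_left h2 (Real.exp_pos (- ∫ x, u x ∂ν)).le
    rw [← mul_assoc, ← Real.exp_add, neg_add_cancel, Real.exp_zero, one_mul, ← Real.exp_add] at h3
    refine h3.trans (Real.exp_le_exp.2 (le_of_eq ?_))
    congr 1
    simp
    rw [div_pow, sq_abs]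
    ring
  · have := jensen_log (ineg iu) ie
    rwa [integral_neg] at this

lemma nice_pres {L K : ℝ} (hL : 0 ≤ L) {b : E → ℝ} (hb : Lip L b) (hn : Nice L K b)
    (r : ℝ) : Nice L (K + L ^ 2 / 2) (fun y => - LS r (fun x => - b x) y) := by
  obtain ⟨D, hDm, hD1, hD2⟩ := hn.exists_measurable
  intro y
  have hbc := hb.cont
  set f : E → ℝ := fun g => - b (y + r • g) with hf
  have hfi : Integrable (fun g => Real.exp (f g)) (G E) := hb.neg.int_exp y r
  set ν := (G E).tilted f with hν
  have : IsProbabilityMeasure ν := isProbabilityMeasure_tilted hfi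
  have hDi : Integrable (fun g => D (y + r • g)) ν :=
    Integrable.of_bound (hDm.comp (by fun_prop)).aestronglyMeasurable L (Filter.Eventually.of_forall fun g => hD1 _)
  refine ⟨∫ g, D (y + r • g) ∂ν, ?_, fun w => ?_⟩
  · refine (norm_integral_le_of_norm_le_const (Filter.Eventually.of_forall fun g => hD1 _)).trans ?_
    simp
  set u : E → ℝ := fun g => ⟪D (y + r • g), w⟫ with hu
  have hum : Measurable u := by fun_prop
  have huR : ∀ g, |u g| ≤ L * ‖w‖ := fun g =>
    (abs_real_inner_le_norm _ _).trans (by gcongr; exact hD1 _)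
  obtain ⟨h1, h2, hie⟩ := hoeff (ν := ν) hum huR
  have hEu : ⟪∫ g, D (y + r • g) ∂ν, w⟫ = ∫ g, u g ∂ν := by
    rw [real_inner_comm, ← integral_inner hDi]
    simp only [hu, real_inner_comm]
  rw [hEu]
  set Δ : E → ℝ := fun g => b (y + r • g) - b (y + w + r • g) with hΔ
  have hΔm : Continuous Δ := by fun_prop
  have hdiff : LS r (fun x => - b x) (y + w) - LS r (fun x => - b x) y
      = Real.log (∫ g, Real.exp (Δ g) ∂ν) := by
    have e : ∀ g, (f + Δ) g = - b (y + w + r • g) := by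
      intro g
      simp only [hf, hΔ, Pi.add_apply]
      ring
    rw [hν, integral_exp_tilted]
    simp_rw [e]
    rw [Real.log_div (hb.neg.pos_exp (y + w) r).ne' (hb.neg.pos_exp y r).ne']
    rfl
  have hΔu : ∀ g, |Δ g + u g| ≤ K * ‖w‖ ^ 2 := by
    intro g
    have := hD2 (y + r • g) w
    rw [← abs_neg] at this
    convert this using 2
    simp only [hΔ, hu]
    rw [show y + w + r • g = y + r • g + w by abel]
    ring
  have iΔ : Integrable (fun g => Real.exp (Δ g)) ν := by
    refine Integrable.of_bound (by fun_prop) (Real.exp (L * ‖w‖ + K * ‖w‖ ^ 2))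
      (Filter.Eventually.of_forall fun g => ?_)
    rw [Real.norm_eq_abs, abs_of_pos (Real.exp_pos _)]
    apply Real.exp_le_exp.2
    have a1 := (abs_le.1 (hΔu g)).2
    have a2 := (abs_le.1 (huR g)).1
    linarith
  have hpos := integral_exp_pos hie
  have hposΔ := integral_exp_pos iΔ
  have up : Real.log (∫ g, Real.exp (Δ g) ∂ν) ≤
      K * ‖w‖ ^ 2 + Real.log (∫ g, Real.exp (- u g) ∂ν) := by
    rw [Real.log_le_iff_le_exp hposΔ, Real.exp_add, Real.exp_log hpos, ← integral_const_mul]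
    refine integral_mono iΔ (hie.const_mul _) fun g => ?_
    simp only
    rw [← Real.exp_add]
    apply Real.exp_le_exp.2
    linarith [(abs_le.1 (hΔu g)).2]
  have lo : Real.log (∫ g, Real.exp (- u g) ∂ν) ≤
      K * ‖w‖ ^ 2 + Real.log (∫ g, Real.exp (Δ g) ∂ν) := by
    rw [Real.log_le_iff_le_exp hpos, Real.exp_add, Real.exp_log hposΔ, ← integral_const_mul]
    refine integral_mono hie (iΔ.const_mul _) fun g => ?_
    simp only
    rw [← Real.exp_add]
    apply Real.exp_le_exp.2
    linarith [(abs_le.1 (hΔu g)).1]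
  rw [abs_le]
  have : 0 ≤ L ^ 2 / 2 * ‖w‖ ^ 2 := by positivity
  constructor
  · nlinarith
  · nlinarith

lemma errC_nonneg (L K : ℝ) : 0 ≤ errC E L K := by
  unfold errC
  exact integral_nonneg fun g => by positivity

lemma LS_zero' (f : E → ℝ) : LS 0 f = f := by
  ext x; simp [LS]

lemma PS_zero' (f : E → ℝ) : PS 0 f = f := by
  ext x; simp [PS]

theorem three_fn {ε L L' K : ℝ} (hL : 0 ≤ L) (hK : 0 ≤ K)
    {F a b : E → ℝ} (hF : Lip L' F) (ha : Lip L' a) (hb : Lip L b) (hn : Nice L K b)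
    (h : ∀ x y, a x - ε ^ 2 * b y ≤ F ((1 - ε) • x + ε • y)) :
    ∫ g, a g ∂(G E) + ε ^ 2 * Real.log (∫ g, Real.exp (- b g) ∂(G E))
      ≤ Real.log (∫ g, Real.exp (F g) ∂(G E)) := by
  set C := errC E L (K + L ^ 2 / 2) with hC
  have main : ∀ N : ℕ, 0 < N → ∀ k : ℕ, ∀ x y : E,
      PS (√(k / N)) a x - ε ^ 2 * (- LS (√(k / N)) (fun x => - b x) y) - k * (ε ^ 2 * C * (1 / N) ^ 2)
        ≤ LS (√(k / N)) F ((1 - ε) • x + ε • y) := by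
    intro N hN k
    have hN' : (0 : ℝ) < N := by exact_mod_cast hN
    have hN1 : (1 : ℝ) ≤ N := by exact_mod_cast hN
    induction k with
    | zero => intro x y; simpa [LS_zero', PS_zero'] using h x y
    | succ k ih =>
      have hδ : 0 < √(1 / (N : ℝ)) := by positivity
      have hδ1 : √(1 / (N : ℝ)) ≤ 1 := by
        rw [Real.sqrt_le_one, div_le_one hN']; exact hN1
      have hR : 0 < √(((k + 1 : ℕ) : ℝ) / N) := by positivity
      have hh : √(((k + 1 : ℕ) : ℝ) / N) ^ 2 = √(1 / (N : ℝ)) ^ 2 + √((k : ℝ) / N) ^ 2 := by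
        rw [Real.sq_sqrt (by positivity), Real.sq_sqrt (by positivity), Real.sq_sqrt (by positivity)]
        push_cast; ring
      have hbk : Lip L (fun y => - LS (√(k / N)) (fun x => - b x) y) := (hb.neg.LS _).neg
      intro x y
      have := step (ε := ε) (κ := k * (ε ^ 2 * C * (1 / N) ^ 2)) hL (by positivity) hδ hδ1
        (hF.LS _) (ha.PS _) hbk (nice_pres hL hb hn _) ih x y
      rw [hF.LS_LS hR hh, ha.PS_PS hR hh] at this
      simp only [neg_neg] at this
      rw [show (fun x => LS √(k / N) (fun x => - b x) x) = LS √(k / N) (fun x => - b x) from rfl,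
        hb.neg.LS_LS hR hh] at this
      refine le_trans (le_of_eq ?_) this
      have e4 : √(1 / (N : ℝ)) ^ 4 = (1 / N) ^ 2 := by
        rw [show (4 : ℕ) = 2 * 2 by norm_num, pow_mul, Real.sq_sqrt (by positivity)]
      rw [e4, ← hC]
      push_cast
      ring
  have fin : ∀ N : ℕ, 0 < N → ∫ g, a g ∂(G E) + ε ^ 2 * Real.log (∫ g, Real.exp (- b g) ∂(G E))
      - ε ^ 2 * C * (1 / N) ≤ Real.log (∫ g, Real.exp (F g) ∂(G E)) := by
    intro N hN
    have hN' : (0 : ℝ) < N := by exact_mod_cast hN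
    have := main N hN N 0 0
    rw [div_self hN'.ne'] at this
    simp only [Real.sqrt_one, PS, LS, smul_zero, add_zero, zero_add, one_smul] at this
    have e : (N : ℝ) * (ε ^ 2 * C * (1 / N) ^ 2) = ε ^ 2 * C * (1 / N) := by field_simp
    rw [e] at this
    linarith
  have lim : Filter.Tendsto (fun N : ℕ => ∫ g, a g ∂(G E) +
      ε ^ 2 * Real.log (∫ g, Real.exp (- b g) ∂(G E)) - ε ^ 2 * C * (1 / N)) Filter.atTop
      (nhds (∫ g, a g ∂(G E) + ε ^ 2 * Real.log (∫ g, Real.exp (- b g) ∂(G E)) - ε ^ 2 * C * 0)) :=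
    (tendsto_one_div_atTop_nhds_zero_nat.const_mul _).const_sub _
  rw [mul_zero, sub_zero] at lim
  refine le_of_tendsto lim ?_
  filter_upwards [Filter.eventually_gt_atTop 0] with N hN using fin N hN

end SNM

namespace SNM

set_option linter.unusedSectionVars false

variable {E : Type*} [NormedAddCommGroup E] [InnerProductSpace ℝ E] [FiniteDimensional ℝ E]
  [MeasurableSpace E] [BorelSpace E]

/-- support function -/
noncomputable def supp (A : Set E) (x : E) : ℝ := sSup ((fun a => ⟪a, x⟫) '' A)

lemma supp_bdd {A : Set E} (hA : IsCompact A) (x : E) : BddAbove ((fun a => ⟪a, x⟫) '' A) :=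
  (hA.image (by fun_prop)).bddAbove

lemma le_supp {A : Set E} (hA : IsCompact A) (x : E) {a : E} (ha : a ∈ A) : ⟪a, x⟫ ≤ supp A x :=
  le_csSup (supp_bdd hA x) ⟨a, ha, rfl⟩

lemma supp_le {A : Set E} (hne : A.Nonempty) {x : E} {t : ℝ} (h : ∀ a ∈ A, ⟪a, x⟫ ≤ t) :
    supp A x ≤ t := by
  apply csSup_le (hne.image _)
  rintro _ ⟨a, ha, rfl⟩
  exact h a ha

lemma supp_add {A : Set E} (hA : IsCompact A) (hne : A.Nonempty) (x y : E) :
    supp A (x + y) ≤ supp A x + supp A y := by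
  apply supp_le hne
  intro a ha
  rw [inner_add_right]
  exact add_le_add (le_supp hA x ha) (le_supp hA y ha)

lemma supp_smul {A : Set E} (hA : IsCompact A) (hne : A.Nonempty) {t : ℝ} (ht : 0 ≤ t) (x : E) :
    supp A (t • x) ≤ t * supp A x := by
  apply supp_le hne
  intro a ha
  rw [inner_smul_right]
  exact mul_le_mul_of_nonneg_left (le_supp hA x ha) ht

lemma supp_lip {A : Set E} (hA : IsCompact A) (hne : A.Nonempty) {R : ℝ}
    (hR : ∀ a ∈ A, ‖a‖ ≤ R) : Lip R (supp A) := by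
  have key : ∀ x y, supp A x ≤ supp A y + R * ‖x - y‖ := by
    intro x y
    apply supp_le hne
    intro a ha
    have h1 := le_supp hA y ha
    have h2 := (abs_le.1 (abs_real_inner_le_norm a (x - y))).2
    have h3 := mul_le_mul_of_nonneg_right (hR a ha) (norm_nonneg (x - y))
    rw [inner_sub_right] at h2
    linarith
  intro x y
  rw [abs_le]
  have h1 := key x y
  have h2 := key y x
  rw [norm_sub_rev] at h2
  constructor <;> linarith

lemma regularize {A : Set E} (hA : IsCompact A) (hc : Convex ℝ A) (hne : A.Nonempty) {R η : ℝ}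
    (hR : ∀ a ∈ A, ‖a‖ ≤ R) (hη : 0 < η) :
    ∃ g : E → ℝ, Lip R g ∧ (∀ x, g x ≤ supp A x) ∧ (∀ x, supp A x ≤ g x + η * R ^ 2 / 2) ∧
      Nice R (1 / (2 * η)) g := by
  have hex : ∀ x : E, ∃ a ∈ A, ∀ a' ∈ A, ⟪a', x⟫ - η * ‖a'‖ ^ 2 / 2 ≤ ⟪a, x⟫ - η * ‖a‖ ^ 2 / 2 := by
    intro x
    obtain ⟨a, ha, hm⟩ := hA.exists_isMaxOn hne
      (f := fun a : E => ⟪a, x⟫ - η * ‖a‖ ^ 2 / 2) (by fun_prop)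
    exact ⟨a, ha, fun a' ha' => hm ha'⟩
  choose p hpA hpmax using hex
  have hR0 : 0 ≤ R := by
    obtain ⟨a, ha⟩ := hne
    exact (norm_nonneg a).trans (hR a ha)
  refine ⟨fun x => ⟪p x, x⟫ - η * ‖p x‖ ^ 2 / 2, ?_, ?_, ?_, ?_⟩
  · have key : ∀ x y, ⟪p x, x⟫ - η * ‖p x‖ ^ 2 / 2 ≤
        ⟪p y, y⟫ - η * ‖p y‖ ^ 2 / 2 + R * ‖x - y‖ := by
      intro x y
      have h1 := hpmax y (p x) (hpA x)
      have h2 := (abs_le.1 (abs_real_inner_le_norm (p x) (x - y))).2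
      have h3 := mul_le_mul_of_nonneg_right (hR _ (hpA x)) (norm_nonneg (x - y))
      rw [inner_sub_right] at h2
      linarith
    intro x y
    rw [abs_le]
    have h1 := key x y
    have h2 := key y x
    rw [norm_sub_rev] at h2
    constructor <;> linarith
  · intro x
    have := le_supp hA x (hpA x)
    have h2 : 0 ≤ η * ‖p x‖ ^ 2 / 2 := by positivity
    simp only
    linarith
  · intro x
    apply supp_le hne
    intro a ha
    have h1 := hpmax x a ha
    have h2 : ‖a‖ ^ 2 ≤ R ^ 2 := by gcongr; exact hR a ha
    have h3 := mul_le_mul_of_nonneg_left h2 hη.le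
    linarith
  · intro x
    refine ⟨p x, hR _ (hpA x), fun w => ?_⟩
    -- first order condition
    have foc : ∀ a ∈ A, ⟪a - p x, x⟫ - η * ⟪p x, a - p x⟫ ≤ 0 := by
      intro a ha
      by_contra hcon
      push Not at hcon
      set d := ⟪a - p x, x⟫ - η * ⟪p x, a - p x⟫ with hd
      have ht : ∀ t : ℝ, 0 < t → t ≤ 1 → d ≤ t * (η * ‖a - p x‖ ^ 2 / 2) := by
        intro t ht ht1
        have hmem : p x + t • (a - p x) ∈ A := hc.add_smul_sub_mem (hpA x) ha ⟨ht.le, ht1⟩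
        have h1 := hpmax x _ hmem
        rw [norm_add_sq_real, inner_add_left, inner_smul_left, inner_smul_right, norm_smul,
          mul_pow] at h1
        simp only [conj_trivial, Real.norm_eq_abs, sq_abs] at h1
        have : t * d ≤ t * (t * (η * ‖a - p x‖ ^ 2 / 2)) := by
          rw [hd]; linarith
        exact le_of_mul_le_mul_left this ht
      set q := η * ‖a - p x‖ ^ 2 / 2 with hq
      have hq0 : 0 ≤ q := by positivity
      have hpos : 0 < min 1 (d / (2 * (q + 1))) := by positivity
      have h5 := ht _ hpos (min_le_left _ _)
      have h6 : min 1 (d / (2 * (q + 1))) * q ≤ d / (2 * (q + 1)) * q :=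
        mul_le_mul_of_nonneg_right (min_le_right _ _) hq0
      have h7 : d / (2 * (q + 1)) * q < d := by
        rw [div_mul_eq_mul_div, div_lt_iff₀ (by positivity)]
        nlinarith
      linarith
    have lower := hpmax (x + w) (p x) (hpA x)
    have f := foc _ (hpA (x + w))
    set a := p (x + w) with ha
    have e : ‖a‖ ^ 2 = ‖p x‖ ^ 2 + 2 * ⟪p x, a - p x⟫ + ‖a - p x‖ ^ 2 := by
      rw [← norm_add_sq_real]; simp
    have cs : ⟪a - p x, w⟫ ≤ η * ‖a - p x‖ ^ 2 / 2 + 1 / (2 * η) * ‖w‖ ^ 2 := by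
      have h2 := (abs_le.1 (abs_real_inner_le_norm (a - p x) w)).2
      have h3 : 0 ≤ (η * ‖a - p x‖ - ‖w‖) ^ 2 / (2 * η) := by positivity
      have h4 : (η * ‖a - p x‖ - ‖w‖) ^ 2 / (2 * η) = η * ‖a - p x‖ ^ 2 / 2
        + 1 / (2 * η) * ‖w‖ ^ 2 - ‖a - p x‖ * ‖w‖ := by field_simp; ring
      linarith
    rw [inner_add_right] at lower
    rw [inner_sub_left] at f cs
    have hkk : 0 ≤ 1 / (2 * η) * ‖w‖ ^ 2 := by positivity
    simp only [← ha]
    rw [abs_le]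
    constructor
    · linarith
    · rw [inner_add_right, e]
      linarith

lemma Lip.const_mul {L : ℝ} {f : E → ℝ} (h : Lip L f) (c : ℝ) : Lip (|c| * L) (fun x => c * f x) := by
  intro x y
  rw [← mul_sub, abs_mul, mul_assoc]
  exact mul_le_mul_of_nonneg_left (h x y) (abs_nonneg c)

lemma Lip.mono {L L' : ℝ} {f : E → ℝ} (h : Lip L f) (hL : L ≤ L') : Lip L' f := by
  intro x y
  exact (h x y).trans (mul_le_mul_of_nonneg_right hL (norm_nonneg _))

lemma log_compare {A : Set E} (hA : IsCompact A) (hc : Convex ℝ A) (hne : A.Nonempty)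
    {s l : ℝ} (hs : 0 < s) (hsl : s ≤ l) :
    (s / l) ^ 2 * Real.log (∫ g, Real.exp (- (l * supp A g)) ∂(G E)) ≤
      Real.log (∫ g, Real.exp (- (s * supp A g)) ∂(G E)) +
        s * (1 - s / l) * ∫ g, supp A g ∂(G E) := by
  have hl : 0 < l := hs.trans_le hsl
  set ε := s / l with hε
  have hε0 : 0 < ε := by positivity
  have hε1 : ε ≤ 1 := (div_le_one hl).2 hsl
  have hsε : s = ε * l := by rw [hε]; field_simp
  obtain ⟨R, hR⟩ := hA.isBounded.exists_norm_le
  have hR0 : 0 ≤ R := by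
    obtain ⟨a, ha⟩ := hne
    exact (norm_nonneg a).trans (hR a ha)
  have hlip := supp_lip hA hne hR
  have main : ∀ η : ℝ, 0 < η →
      ε ^ 2 * Real.log (∫ g, Real.exp (- (l * supp A g)) ∂(G E)) ≤
      Real.log (∫ g, Real.exp (- (s * supp A g)) ∂(G E)) +
        s * (1 - ε) * ∫ g, supp A g ∂(G E) + η * (ε ^ 2 * l * R ^ 2 / 2) := by
    intro η hη
    obtain ⟨φ, h1, h2, h3, h4⟩ := regularize hA hc hne hR hη
    have hF : Lip (l * R) (fun x => - s * supp A x) := (hlip.const_mul _).mono (by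
      rw [abs_neg, abs_of_pos hs]; gcongr)
    have ha : Lip (l * R) (fun x => (- s * (1 - ε)) * supp A x) := (hlip.const_mul _).mono (by
      rw [abs_mul, abs_neg, abs_of_pos hs, abs_of_nonneg (by linarith)]
      gcongr
      nlinarith)
    have hb : Lip (l * R) (fun x => l * φ x + l * (η * R ^ 2 / 2)) := by
      have := h1.const_mul l
      rw [abs_of_pos hl] at this
      intro x y
      rw [add_sub_add_right_eq_sub]
      exact this x y
    have hnice : Nice (l * R) (l * (1 / (2 * η))) (fun x => l * φ x + l * (η * R ^ 2 / 2)) := by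
      intro y
      obtain ⟨p, hp1, hp2⟩ := h4 y
      refine ⟨l • p, ?_, fun w => ?_⟩
      · rw [norm_smul, Real.norm_eq_abs, abs_of_pos hl]; gcongr
      · rw [inner_smul_left]
        have := mul_le_mul_of_nonneg_left (hp2 w) hl.le
        rw [← abs_of_pos hl, ← abs_mul, abs_of_pos hl] at this
        rw [mul_assoc]
        have e : l * φ (y + w) + l * (η * R ^ 2 / 2) - (l * φ y + l * (η * R ^ 2 / 2)) -
            (starRingEnd ℝ) l * ⟪p, w⟫ = l * (φ (y + w) - φ y - ⟪p, w⟫) := by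
          rw [conj_trivial]; ring
        rw [e]
        exact this
    have := three_fn (ε := ε) (by positivity) (by positivity) hF ha hb hnice (by
      intro x y
      have e1 := supp_add hA hne ((1 - ε) • x) (ε • y)
      have e2 := supp_smul hA hne (by linarith : 0 ≤ 1 - ε) x
      have e3 := supp_smul hA hne hε0.le y
      have e4 := h3 y
      have e5 : supp A ((1 - ε) • x + ε • y) ≤ (1 - ε) * supp A x + ε * (φ y + η * R ^ 2 / 2) := by
        have := mul_le_mul_of_nonneg_left e4 hε0.le
        linarith
      have e6 := mul_le_mul_of_nonneg_left e5 hs.le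
      have e7 : s * (ε * (φ y + η * R ^ 2 / 2)) = ε ^ 2 * (l * φ y + l * (η * R ^ 2 / 2)) := by
        rw [hsε]; ring
      linarith)
    rw [integral_const_mul] at this
    have e8 : Real.log (∫ g, Real.exp (- (l * supp A g)) ∂(G E)) - l * (η * R ^ 2 / 2) ≤
        Real.log (∫ g, Real.exp (- (l * φ g + l * (η * R ^ 2 / 2))) ∂(G E)) := by
      have hi1 : Integrable (fun g => Real.exp (- (l * supp A g))) (G E) := by
        have := (hlip.const_mul l).neg.int_exp 0 1
        simpa using this
      have hi2 : Integrable (fun g => Real.exp (- (l * φ g + l * (η * R ^ 2 / 2)))) (G E) := by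
        have := hb.neg.int_exp 0 1
        simpa using this
      have hp1 := integral_exp_pos hi1
      have hp2 := integral_exp_pos hi2
      rw [← Real.exp_le_exp, Real.exp_sub, Real.exp_log hp1, Real.exp_log hp2, div_eq_mul_inv,
        ← Real.exp_neg, ← integral_mul_const]
      refine integral_mono (hi1.mul_const _) hi2 fun g => ?_
      simp only
      rw [← Real.exp_add]
      apply Real.exp_le_exp.2
      have := mul_le_mul_of_nonneg_left (h2 g) hl.le
      linarith
    have e9 := mul_le_mul_of_nonneg_left e8 (sq_nonneg ε)
    have e10 : ∀ g, - s * supp A g = - (s * supp A g) := by intro g; ring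
    simp_rw [e10] at this
    linarith
  have hk : 0 ≤ ε ^ 2 * l * R ^ 2 / 2 := by positivity
  apply le_of_forall_pos_le_add
  intro δ hδ
  have := main (δ / (ε ^ 2 * l * R ^ 2 / 2 + 1)) (by positivity)
  refine this.trans ?_
  gcongr
  rw [div_mul_eq_mul_div, div_le_iff₀ (by positivity)]
  nlinarith

lemma exp_neg_quad {u : ℝ} (hu : -1 ≤ u) : Real.exp (-u) ≤ 1 - u + u ^ 2 := by
  rcases le_or_gt u 1 with h | h
  · have := abs_le.1 (Real.abs_exp_sub_one_sub_id_le (x := -u) (by rw [abs_neg, abs_le]; exact ⟨hu, h⟩))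
    nlinarith [this.2]
  · have : Real.exp (-u) ≤ 1 := Real.exp_le_one_iff.2 (by linarith)
    nlinarith

/-- Lower-tail sub-Gaussian bound. -/
theorem lemmaA {A : Set E} (hA : IsCompact A) (hc : Convex ℝ A) (hne : A.Nonempty)
    (hpos : ∀ x, 0 ≤ supp A x) {m V : ℝ} (hm : m = ∫ g, supp A g ∂(G E)) (hm0 : 0 < m)
    (hV : V = ∫ g, (supp A g - m) ^ 2 ∂(G E)) {l : ℝ} (hl : 0 ≤ l) :
    ∫ g, Real.exp (- (l * (supp A g - m))) ∂(G E) ≤ Real.exp (l ^ 2 * V) := by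
  obtain ⟨R, hR⟩ := hA.isBounded.exists_norm_le
  have hlip := supp_lip hA hne hR
  have hcont := hlip.cont
  rcases hl.eq_or_lt with rfl | hl
  · simp
  have hi1 : ∀ l : ℝ, Integrable (fun g => Real.exp (- (l * supp A g))) (G E) := by
    intro l
    have := (hlip.const_mul l).neg.int_exp 0 1
    simpa using this
  have hi0 : Integrable (supp A) (G E) := by simpa using hlip.int 0 1
  have hsq : Integrable (fun g => (supp A g - m) ^ 2) (G E) := by
    refine integrable_of_growth (by fun_prop) (Real.exp (2 * (|supp A 0| + |m|))) (2 * R) fun g => ?_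
    rw [abs_of_nonneg (by positivity), ← Real.exp_add, ← sq_abs,
      show 2 * (|supp A 0| + |m|) + 2 * R * ‖g‖ = 2 * (|supp A 0| + |m| + R * ‖g‖) by ring,
      show (2 : ℝ) = ((2 : ℕ) : ℝ) by norm_num, Real.exp_nat_mul]
    gcongr
    refine le_trans ?_ (le_exp_self _)
    have h1 := hlip g 0
    rw [sub_zero] at h1
    have h2 := abs_sub_abs_le_abs_sub (supp A g) (supp A 0)
    have h3 := abs_sub (supp A g) m
    linarith
  have conv : ∀ l : ℝ, ∫ g, Real.exp (- (l * (supp A g - m))) ∂(G E) =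
      Real.exp (l * m) * ∫ g, Real.exp (- (l * supp A g)) ∂(G E) := by
    intro l
    rw [← integral_const_mul]
    congr 1
    ext g
    rw [← Real.exp_add]
    congr 1
    ring
  set s := min l (1 / m) with hs
  have hs0 : 0 < s := by positivity
  have hsl : s ≤ l := min_le_left _ _
  have hsm : s * m ≤ 1 := by
    have : s ≤ 1 / m := min_le_right _ _
    rwa [le_div_iff₀ hm0] at this
  have hi1' : Integrable (fun g => Real.exp (- (s * (supp A g - m)))) (G E) := by
    refine ((hi1 s).const_mul (Real.exp (s * m))).congr (Filter.Eventually.of_forall fun g => ?_)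
    simp only
    rw [← Real.exp_add]
    congr 1
    ring
  have small : ∫ g, Real.exp (- (s * (supp A g - m))) ∂(G E) ≤ 1 + s ^ 2 * V := by
    have : 1 + s ^ 2 * V = ∫ g, (1 - s * (supp A g - m) + s ^ 2 * (supp A g - m) ^ 2) ∂(G E) := by
      rw [integral_add (isub (integrable_const _) ((isub hi0 (integrable_const _)).const_mul _))
        (hsq.const_mul _), integral_sub (integrable_const _)
        ((isub hi0 (integrable_const _)).const_mul _), integral_const_mul, integral_const_mul,
        integral_sub hi0 (integrable_const _), ← hm, ← hV]
      simp
    rw [this]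
    refine integral_mono hi1' (iadd (isub (integrable_const _)
      ((isub hi0 (integrable_const _)).const_mul _)) (hsq.const_mul _)) fun g => ?_
    simp only
    have h1 := exp_neg_quad (u := s * (supp A g - m)) (by
      have := mul_nonneg hs0.le (hpos g)
      linarith)
    rw [mul_pow] at h1
    exact h1
  have hcmp := log_compare hA hc hne hs0 hsl
  rw [← hm] at hcmp
  have hlogs : Real.log (∫ g, Real.exp (- (s * supp A g)) ∂(G E)) + s * m ≤ s ^ 2 * V := by
    have h1 := Real.log_le_sub_one_of_pos (integral_exp_pos hi1')
    rw [conv s, Real.log_mul (Real.exp_pos _).ne' (integral_exp_pos (hi1 s)).ne', Real.log_exp] at h1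
    rw [conv s] at small
    linarith
  have hlogl : Real.log (∫ g, Real.exp (- (l * supp A g)) ∂(G E)) + l * m ≤ l ^ 2 * V := by
    have h3 : (s / l) ^ 2 * (Real.log (∫ g, Real.exp (- (l * supp A g)) ∂(G E)) + l * m) ≤
        (s / l) ^ 2 * (l ^ 2 * V) := by
      have e1 : (s / l) ^ 2 * (l ^ 2 * V) = s ^ 2 * V := by field_simp
      have e2 : (s / l) ^ 2 * (l * m) = s * (s / l) * m := by field_simp
      rw [e1, mul_add, e2]
      linarith
    exact le_of_mul_le_mul_left h3 (by positivity)
  rw [conv l, ← Real.exp_log (integral_exp_pos (hi1 l)), ← Real.exp_add]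
  apply Real.exp_le_exp.2
  linarith

end SNM

namespace SNM

set_option linter.unusedSectionVars false

variable {E : Type*} [NormedAddCommGroup E] [InnerProductSpace ℝ E] [FiniteDimensional ℝ E]
  [MeasurableSpace E] [BorelSpace E]

/-- Normalised seminorm with a lower sub-Gaussian tail. -/
structure SN (N : E → ℝ) (β : ℝ) : Prop where
  nonneg : ∀ x, 0 ≤ N x
  sub : ∀ x y, N (x + y) ≤ N x + N y
  homog : ∀ (t : ℝ) x, N (t • x) = |t| * N x
  lip : ∃ R, Lip R N
  mean : ∫ x, N x ∂(G E) = 1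
  var : ∫ x, (N x - 1) ^ 2 ∂(G E) = β
  mgf : ∀ l : ℝ, 0 ≤ l → ∫ x, Real.exp (- (l * (N x - 1))) ∂(G E) ≤ Real.exp (l ^ 2 * β)

variable {N : E → ℝ} {β : ℝ}

lemma Lip.int_sq {R : ℝ} {f : E → ℝ} (h : Lip R f) : Integrable (fun g => (f g) ^ 2) (G E) := by
  have hcont := h.cont
  refine integrable_of_growth (by fun_prop) (Real.exp (2 * (|f 0|))) (2 * R) fun g => ?_
  rw [abs_of_nonneg (by positivity), ← Real.exp_add, ← sq_abs,
    show 2 * (|f 0|) + 2 * R * ‖g‖ = 2 * (|f 0| + R * ‖g‖) by ring,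
    show (2 : ℝ) = ((2 : ℕ) : ℝ) by norm_num, Real.exp_nat_mul]
  gcongr
  refine le_trans ?_ (le_exp_self _)
  have h1 := h g 0
  rw [sub_zero] at h1
  have h2 := abs_sub_abs_le_abs_sub (f g) (f 0)
  linarith

lemma SN.cont (h : SN N β) : Continuous N := by
  obtain ⟨R, hR⟩ := h.lip
  exact hR.cont

lemma SN.int (h : SN N β) : Integrable N (G E) := by
  obtain ⟨R, hR⟩ := h.lip
  simpa using hR.int 0 1

lemma SN.int_sq (h : SN N β) : Integrable (fun x => N x ^ 2) (G E) := by
  obtain ⟨R, hR⟩ := h.lip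
  exact hR.int_sq

lemma SN.neg (h : SN N β) (x : E) : N (-x) = N x := by
  have := h.homog (-1) x
  simpa using this

lemma SN.sub' (h : SN N β) (x y : E) : N (x - y) ≤ N x + N y := by
  have := h.sub x (-y)
  rwa [h.neg, ← sub_eq_add_neg] at this

lemma SN.ints (h : SN N β) : ∫ x, N x ^ 2 ∂(G E) = 1 + β := by
  have h1 := h.var
  have e : ∀ x, (N x - 1) ^ 2 = N x ^ 2 - 2 * N x + 1 := by intro x; ring
  simp_rw [e] at h1
  rw [integral_add (isub h.int_sq (h.int.const_mul 2)) (integrable_const _),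
    integral_sub h.int_sq (h.int.const_mul 2), integral_const_mul, h.mean] at h1
  simp at h1
  linarith

lemma hcc : (1 / √2 : ℝ) ^ 2 + (1 / √2 : ℝ) ^ 2 = 1 := by
  rw [div_pow, Real.sq_sqrt (by norm_num)]; norm_num

lemma SN.beta_le (h : SN N β) : β ≤ 1 := by
  have hc := h.cont
  have mp := measurePreserving_rot (E := E) (1 / √2) (1 / √2) hcc
  set T : E × E → E × E := fun p =>
    ((1 / √2 : ℝ) • p.1 + (1 / √2 : ℝ) • p.2, (-(1 / √2) : ℝ) • p.1 + (1 / √2 : ℝ) • p.2) with hT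
  have i0 : Integrable (fun p : E × E => N p.1 * N p.2) ((G E).prod (G E)) := h.int.mul_prod h.int
  have i1 : Integrable (fun p : E × E => N (T p).1 * N (T p).2) ((G E).prod (G E)) :=
    mp.integrable_comp_of_integrable i0
  have e1 : ∫ p, N (T p).1 * N (T p).2 ∂((G E).prod (G E)) = 1 := by
    have hm := mp.map_eq
    have : ∫ p, N p.1 * N p.2 ∂((G E).prod (G E)) = ∫ p, N (T p).1 * N (T p).2 ∂((G E).prod (G E)) := by
      conv_lhs => rw [← hm]
      rw [integral_map mp.measurable.aemeasurable (by rw [hm]; exact i0.1)]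
    rw [← this, integral_prod_mul, h.mean, one_mul]
  have j1 : Integrable (fun p : E × E => N p.1 ^ 2) ((G E).prod (G E)) := h.int_sq.comp_fst (G E)
  have j2 : Integrable (fun p : E × E => N p.2 ^ 2) ((G E).prod (G E)) := h.int_sq.comp_snd (G E)
  have e2 : ∫ p, (N p.1 ^ 2 + N p.2 ^ 2 - 2 * (N p.1 * N p.2)) ∂((G E).prod (G E)) = 2 * β := by
    rw [integral_sub (iadd j1 j2) (i0.const_mul 2), integral_add j1 j2, integral_const_mul,
      integral_prod_mul, h.mean, integral_fun_fst (fun x => N x ^ 2),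
      integral_fun_snd (fun x => N x ^ 2), h.ints]
    simp
    ring
  have e3 : ∫ p, (N p.1 ^ 2 + N p.2 ^ 2 - 2 * (N p.1 * N p.2)) ∂((G E).prod (G E)) ≤
      ∫ p, 2 * (N (T p).1 * N (T p).2) ∂((G E).prod (G E)) := by
    refine integral_mono (isub (iadd j1 j2) (i0.const_mul 2)) (i1.const_mul 2) fun p => ?_
    simp only
    have a1 : N (T p).1 = 1 / √2 * N (p.1 + p.2) := by
      simp only [hT]; rw [← smul_add, h.homog, abs_of_pos (by positivity)]
    have a2 : N (T p).2 = 1 / √2 * N (p.2 - p.1) := by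
      simp only [hT]
      rw [neg_smul, neg_add_eq_sub, ← smul_sub, h.homog, abs_of_pos (by positivity)]
    have a3 : 2 * (N (T p).1 * N (T p).2) = N (p.1 + p.2) * N (p.2 - p.1) := by
      rw [a1, a2]
      have := Real.sq_sqrt (show (0:ℝ) ≤ 2 by norm_num)
      field_simp
      rw [this]
    rw [a3]
    have b1 : |N p.1 - N p.2| ≤ N (p.1 + p.2) := by
      have c1 := h.sub' (p.1 + p.2) p.2
      have c2 := h.sub' (p.1 + p.2) p.1
      rw [add_sub_cancel_right] at c1
      rw [add_sub_cancel_left] at c2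
      rw [abs_le]; constructor <;> linarith
    have b2 : |N p.1 - N p.2| ≤ N (p.2 - p.1) := by
      have c1 := h.sub (p.2 - p.1) p.1
      have c2 := h.sub' p.2 (p.2 - p.1)
      rw [sub_add_cancel] at c1
      rw [sub_sub_cancel] at c2
      rw [abs_le]; constructor <;> linarith
    have := mul_le_mul b1 b2 (abs_nonneg _) (h.nonneg _)
    rw [abs_mul_abs_self] at this
    linarith
  rw [e2, integral_const_mul, e1] at e3
  linarith

lemma SN.tail (h : SN N β) (hβ : 0 < β) {t : ℝ} (ht : t ≤ 1) :
    (G E).real {x | N x ≤ t} ≤ Real.exp (-(1 - t) ^ 2 / (4 * β)) := by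
  have hc := h.cont
  obtain ⟨R, hR⟩ := h.lip
  set l := (1 - t) / (2 * β) with hl
  have hl0 : 0 ≤ l := div_nonneg (by linarith) (by positivity)
  have hi : Integrable (fun x => Real.exp (- (l * (N x - 1)))) (G E) := by
    have := ((hR.const_mul l).neg.int_exp 0 1).const_mul (Real.exp l)
    refine this.congr (Filter.Eventually.of_forall fun g => ?_)
    simp only
    rw [← Real.exp_add, zero_add, one_smul]
    congr 1
    ring
  have h1 := mul_meas_ge_le_integral_of_nonneg (μ := G E) (f := fun x => Real.exp (- (l * (N x - 1))))
    (Filter.Eventually.of_forall fun x => (Real.exp_pos _).le) hi (Real.exp (l * (1 - t)))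
  have hset : {x | N x ≤ t} ⊆ {x | Real.exp (l * (1 - t)) ≤ Real.exp (- (l * (N x - 1)))} := by
    intro x hx
    simp only [mem_ofPred_eq] at hx ⊢
    apply Real.exp_le_exp.2
    nlinarith
  have h2 := measureReal_mono (μ := G E) hset
  have h3 : Real.exp (l * (1 - t)) * (G E).real {x | N x ≤ t} ≤ Real.exp (l ^ 2 * β) :=
    (mul_le_mul_of_nonneg_left h2 (Real.exp_pos _).le).trans (h1.trans (h.mgf l hl0))
  have h4 := mul_le_mul_of_nonneg_left h3 (Real.exp_pos (-(l * (1 - t)))).le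
  rw [← mul_assoc, ← Real.exp_add, neg_add_cancel, Real.exp_zero, one_mul, ← Real.exp_add] at h4
  refine h4.trans (Real.exp_le_exp.2 (le_of_eq ?_))
  rw [hl]
  field_simp
  ring

lemma SN.meas_ball (h : SN N β) (x : E) (t : ℝ) : MeasurableSet {z | N (z - x) ≤ t} := by
  have hc := h.cont
  exact (isClosed_le (by fun_prop) continuous_const).measurableSet

lemma SN.symm (h : SN N β) (x : E) (t : ℝ) :
    (G E).real {z | N (z - x) ≤ t} ^ 2 ≤ (G E).real {z | N z ≤ √2 * t} := by
  have hc := h.cont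
  have mp := measurePreserving_rot (E := E) (1 / √2) (1 / √2) hcc
  have mp2 := (measurePreserving_snd (μ := G E) (ν := G E)).comp mp
  have e1 : (G E).real {z | N z ≤ √2 * t} = ((G E).prod (G E)).real
      {p | N ((-(1 / √2) : ℝ) • p.1 + (1 / √2 : ℝ) • p.2) ≤ √2 * t} := by
    have := mp2.measureReal_preimage (s := {z | N z ≤ √2 * t})
      (isClosed_le (by fun_prop) continuous_const).measurableSet.nullMeasurableSet
    rw [← this]
    rfl
  rw [e1, sq, ← measureReal_prod_prod]
  refine measureReal_mono ?_ (by finiteness)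
  rintro ⟨p, q⟩ ⟨hp, hq⟩
  simp only [mem_ofPred_eq] at hp hq ⊢
  rw [neg_smul, neg_add_eq_sub, ← smul_sub, h.homog, abs_of_pos (by positivity)]
  have h1 := h.sub' (q - x) (p - x)
  rw [sub_sub_sub_cancel_right] at h1
  have h2 : N (q - p) ≤ 2 * t := by linarith
  have h3 : √2 * t = 1 / √2 * (2 * t) := by
    have := Real.sq_sqrt (show (0:ℝ) ≤ 2 by norm_num)
    field_simp
    rw [this]
    ring
  rw [h3]
  gcongr

lemma SN.markov (h : SN N β) {M : ℝ} (hM : 0 < M) : 1 - 1 / M ≤ (G E).real {z | N z ≤ M} := by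
  have hc := h.cont
  have h1 := mul_meas_ge_le_integral_of_nonneg (μ := G E) (f := N)
    (Filter.Eventually.of_forall h.nonneg) h.int M
  rw [h.mean] at h1
  have h2 : (G E).real {z | N z ≤ M}ᶜ ≤ (G E).real {z | M ≤ N z} := by
    refine measureReal_mono ?_ (by finiteness)
    intro z hz
    simp only [mem_compl_iff, mem_ofPred_eq, not_le] at hz ⊢
    exact hz.le
  rw [probReal_compl_eq_one_sub (isClosed_le (by fun_prop) continuous_const).measurableSet] at h2
  have h3 : (G E).real {z | M ≤ N z} ≤ 1 / M := by
    rw [le_div_iff₀ hM]; linarith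
  linarith

lemma SN.recur (h : SN N β) {c0 c1 M ε Q : ℝ} (hc0 : 0 ≤ c0) (hc0' : c0 ≤ 1) (hc1 : 0 < c1)
    (hcs : c0 ^ 2 + c1 ^ 2 = 1) (hM : 0 < M) (hε : 0 ≤ ε)
    (hQ : ∀ y, (G E).real {z | N (z - y) ≤ ε / c1} ≤ Q) (x : E) :
    (G E).real {z | N (z - x) ≤ ε} * (1 - 1 / M) ≤
      (G E).real {z | N (z - c0 • x) ≤ ε + c1 * M} * Q := by
  have hc := h.cont
  have mp := measurePreserving_rot (E := E) c0 c1 hcs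
  set B : Set (E × E) := {p | N (p.1 - c0 • x) ≤ ε + c1 * M ∧ N (c0 • p.1 + c1 • p.2 - x) ≤ ε} with hB
  have hBm : MeasurableSet B :=
    ((isClosed_le (f := fun p : E × E => N (p.1 - c0 • x)) (by fun_prop) continuous_const).inter
      (isClosed_le (f := fun p : E × E => N (c0 • p.1 + c1 • p.2 - x)) (by fun_prop)
        continuous_const)).measurableSet
  have s1 : (G E).real {z | N (z - x) ≤ ε} * (1 - 1 / M) ≤ ((G E).prod (G E)).real B := by
    calc _ ≤ (G E).real {z | N (z - x) ≤ ε} * (G E).real {z | N z ≤ M} := by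
          gcongr; exact h.markov hM
      _ = ((G E).prod (G E)).real ({z | N (z - x) ≤ ε} ×ˢ {z | N z ≤ M}) :=
          (measureReal_prod_prod _ _).symm
      _ = ((G E).prod (G E)).real ((fun p : E × E => (c0 • p.1 + c1 • p.2, (-c1) • p.1 + c0 • p.2)) ⁻¹'
            ({z | N (z - x) ≤ ε} ×ˢ {z | N z ≤ M})) := by
          refine (mp.measureReal_preimage ?_).symm
          exact ((h.meas_ball x ε).prod
            (isClosed_le (by fun_prop) continuous_const).measurableSet).nullMeasurableSet
      _ ≤ _ := by
          refine measureReal_mono ?_ (by finiteness)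
          rintro ⟨p, q⟩ ⟨hp, hq⟩
          simp only [mem_ofPred_eq] at hp hq
          refine ⟨?_, hp⟩
          simp only
          have e : p - c0 • x = c0 • (c0 • p + c1 • q - x) - c1 • ((-c1) • p + c0 • q) := by
            have : p = (c0 ^ 2 + c1 ^ 2) • p := by rw [hcs, one_smul]
            nth_rewrite 1 [this]
            module
          rw [e]
          refine (h.sub' _ _).trans ?_
          rw [h.homog, h.homog, abs_of_nonneg hc0, abs_of_pos hc1]
          have := h.nonneg (c0 • p + c1 • q - x)
          have h3 : c1 * N ((-c1) • p + c0 • q) ≤ c1 * M := by gcongr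
          nlinarith
  refine s1.trans ?_
  have hQ0 : 0 ≤ Q := measureReal_nonneg.trans (hQ 0)
  have s2 : ((G E).prod (G E)) B ≤ (G E) {z | N (z - c0 • x) ≤ ε + c1 * M} * ENNReal.ofReal Q := by
    rw [Measure.prod_apply hBm]
    calc ∫⁻ z, (G E) (Prod.mk z ⁻¹' B) ∂(G E) ≤
        ∫⁻ z, ({z | N (z - c0 • x) ≤ ε + c1 * M}.indicator (fun _ => ENNReal.ofReal Q)) z ∂(G E) := by
          apply lintegral_mono
          intro z
          by_cases hz : N (z - c0 • x) ≤ ε + c1 * M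
          · rw [indicator_of_mem (by exact hz)]
            have h1 := hQ (c1⁻¹ • (x - c0 • z))
            rw [measureReal_def] at h1
            have h2 := (ENNReal.le_ofReal_iff_toReal_le (measure_ne_top _ _) hQ0).2 h1
            refine le_trans (measure_mono ?_) h2
            rintro w ⟨_, hw⟩
            simp only [mem_ofPred_eq] at hw ⊢
            have e : w - c1⁻¹ • (x - c0 • z) = c1⁻¹ • (c0 • z + c1 • w - x) := by
              rw [smul_sub, smul_sub, smul_add, smul_smul c1⁻¹ c1, inv_mul_cancel₀ hc1.ne', one_smul]
              abel
            rw [e, h.homog, abs_of_pos (inv_pos.2 hc1), div_eq_inv_mul]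
            gcongr
          · rw [indicator_of_notMem (by exact hz)]
            have : Prod.mk z ⁻¹' B = ∅ := by
              ext w
              simp only [hB, mem_preimage, mem_ofPred_eq, mem_empty_iff_false, iff_false]
              exact fun hh => hz hh.1
            simp [this]
      _ = _ := by
          rw [lintegral_indicator_const (h.meas_ball _ _), mul_comm]
  have s3 := ENNReal.toReal_mono (by finiteness) s2
  rw [ENNReal.toReal_mul, ENNReal.toReal_ofReal hQ0] at s3
  exact s3

lemma SN.small (h : SN N β) (hβ : 0 < β) (k : ℕ) : ∀ x,
    (G E).real {z | N (z - x) ≤ (1 / 200 : ℝ) ^ k} ≤ Real.exp (- (k / (64 * β))) := by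
  induction k with
  | zero => intro x; simp
  | succ k ih =>
    intro x
    have hκ : (1 - (1 / 200 : ℝ) ^ 2) ≥ 0 := by norm_num
    have h1 := h.recur (c0 := √(1 - (1 / 200 : ℝ) ^ 2)) (c1 := 1 / 200) (M := 65)
      (ε := (1 / 200 : ℝ) ^ (k + 1)) (Q := Real.exp (- (k / (64 * β)))) (by positivity)
      (by rw [Real.sqrt_le_one]; norm_num) (by norm_num) (by rw [Real.sq_sqrt hκ]; ring)
      (by norm_num) (by positivity) (by
        intro y
        have := ih y
        rwa [pow_succ, mul_div_assoc, div_self (by norm_num), mul_one]) x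
    set y := √(1 - (1 / 200 : ℝ) ^ 2) • x
    have hth : (1 / 200 : ℝ) ^ (k + 1) + 1 / 200 * 65 ≤ 66 / 200 := by
      have : (1 / 200 : ℝ) ^ k ≤ 1 := pow_le_one₀ (by norm_num) (by norm_num)
      rw [pow_succ]; linarith
    have h2 : (G E).real {z | N (z - y) ≤ (1 / 200 : ℝ) ^ (k + 1) + 1 / 200 * 65} ≤
        Real.exp (- (1 / (32 * β))) := by
      have a1 := h.symm y (66 / 200)
      have a2 := h.tail hβ (t := 1 / 2) (by norm_num)
      have hs : √2 * (66 / 200) ≤ 1 / 2 := by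
        have : √2 ≤ 1.5 := by rw [Real.sqrt_le_left (by norm_num)]; norm_num
        linarith
      have a3 : (G E).real {z | N z ≤ √2 * (66 / 200)} ≤ (G E).real {z | N z ≤ 1 / 2} :=
        measureReal_mono (fun z hz => le_trans hz hs)
      have a4 : (G E).real {z | N (z - y) ≤ (1 / 200 : ℝ) ^ (k + 1) + 1 / 200 * 65} ≤
        (G E).real {z | N (z - y) ≤ 66 / 200} := measureReal_mono (fun z hz => le_trans hz hth)
      refine a4.trans ?_
      refine le_of_sq_le_sq ?_ (Real.exp_pos _).le
      refine (a1.trans (a3.trans a2)).trans (le_of_eq ?_)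
      rw [← Real.exp_nat_mul]
      congr 1
      field_simp
      norm_num
    have h3 : Real.exp (- (1 / (64 * β))) ≤ 1 - 1 / 65 := by
      have hb1 := h.beta_le
      have b1 : Real.exp (- (1 / (64 * β))) ≤ Real.exp (-(1 / 64)) := by
        apply Real.exp_le_exp.2
        apply neg_le_neg
        apply one_div_le_one_div_of_le (by positivity)
        linarith
      refine b1.trans ?_
      rw [Real.exp_neg, inv_le_comm₀ (Real.exp_pos _) (by norm_num)]
      have := Real.add_one_le_exp (1 / 64 : ℝ)
      norm_num at this ⊢
      linarith
    have h4 : (G E).real {z | N (z - x) ≤ (1 / 200 : ℝ) ^ (k + 1)} * Real.exp (- (1 / (64 * β))) ≤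
        Real.exp (- (1 / (32 * β))) * Real.exp (- (k / (64 * β))) :=
      (mul_le_mul_of_nonneg_left h3 measureReal_nonneg).trans
        (h1.trans (mul_le_mul_of_nonneg_right h2 (Real.exp_pos _).le))
    have h5 := mul_le_mul_of_nonneg_right h4 (Real.exp_pos (1 / (64 * β))).le
    rw [mul_assoc, ← Real.exp_add, neg_add_cancel, Real.exp_zero, mul_one, ← Real.exp_add,
      ← Real.exp_add] at h5
    refine h5.trans (Real.exp_le_exp.2 (le_of_eq ?_))
    push_cast
    field_simp
    ring

end SNM

namespace SNM

set_option linter.unusedSectionVars false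

variable {E : Type*} [NormedAddCommGroup E] [InnerProductSpace ℝ E] [FiniteDimensional ℝ E]
  [MeasurableSpace E] [BorelSpace E]

variable {N : E → ℝ} {β : ℝ}

/-- the small constant -/
noncomputable def cc : ℝ := 1 / (256 * Real.log 200)

lemma log200 : 1 ≤ Real.log 200 := by
  rw [Real.le_log_iff_exp_le (by norm_num)]
  have := Real.exp_one_lt_d9
  linarith

lemma cc_pos : 0 < cc := by
  have := log200
  unfold cc; positivity

lemma cc_le : cc ≤ 1 := by
  have := log200
  unfold cc
  rw [div_le_one (by positivity)]
  linarith

/-- absolute constant -/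
noncomputable def TT : ℝ := ∑' k : ℕ, Real.exp (-(1 / 128)) * Real.exp (-(1 / 128)) ^ k

lemma TT_sum : Summable (fun k : ℕ => Real.exp (-(1 / 128)) * Real.exp (-(1 / 128)) ^ k) := by
  apply Summable.mul_left
  exact summable_geometric_of_lt_one (Real.exp_pos _).le (by rw [Real.exp_lt_one_iff]; norm_num)

lemma TT_nonneg : 0 ≤ TT := tsum_nonneg fun k => by positivity

lemma pointwise {x q : ℝ} (hx : 0 ≤ x) (hq : 0 < q) :
    ENNReal.ofReal (x ^ (-q)) ≤ 1 + ENNReal.ofReal (Real.exp (-(200 * q * (x - 1)))) +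
      ∑' k : ℕ, (if x ≤ (1 / 200 : ℝ) ^ (k + 1) then
        ENNReal.ofReal (Real.exp (q * (k + 2) * Real.log 200)) else 0) := by
  rcases hx.eq_or_lt with rfl | hx
  · rw [Real.zero_rpow (by linarith)]; simp
  rcases le_or_gt 1 x with h1 | h1
  · have : x ^ (-q) ≤ 1 := Real.rpow_le_one_of_one_le_of_nonpos h1 (by linarith)
    have h2 : ENNReal.ofReal (x ^ (-q)) ≤ 1 := by
      rw [← ENNReal.ofReal_one]; exact ENNReal.ofReal_le_ofReal this
    exact h2.trans (by rw [add_assoc]; exact le_self_add)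
  rcases le_or_gt (1 / 200) x with h2 | h2
  · have h3 : x ^ (-q) ≤ Real.exp (-(200 * q * (x - 1))) := by
      rw [Real.rpow_def_of_pos hx]
      apply Real.exp_le_exp.2
      have h4 := Real.one_sub_inv_le_log_of_pos hx
      have h5 : x⁻¹ - 1 ≤ 200 * (1 - x) := by
        have : x⁻¹ - 1 = (1 - x) * x⁻¹ := by field_simp
        rw [this, mul_comm]
        apply mul_le_mul_of_nonneg_right _ (by linarith)
        rw [inv_le_comm₀ hx (by norm_num)]
        linarith
      nlinarith
    refine (ENNReal.ofReal_le_ofReal h3).trans ?_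
    rw [add_right_comm]
    exact le_add_self
  · obtain ⟨k, hk1, hk2⟩ := exists_nat_pow_near_of_lt_one (x := x * 200) (y := (1 / 200 : ℝ))
      (by positivity) (by linarith) (by norm_num) (by norm_num)
    refine le_trans ?_ le_add_self
    refine le_trans ?_ (ENNReal.le_tsum k)
    rw [if_pos (by rw [pow_succ]; linarith)]
    apply ENNReal.ofReal_le_ofReal
    rw [Real.rpow_def_of_pos hx]
    apply Real.exp_le_exp.2
    have h6 : (1 / 200 : ℝ) ^ (k + 2) ≤ x := by
      rw [show k + 2 = (k + 1) + 1 by rfl, pow_succ]; linarith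
    have h7 := Real.log_le_log (by positivity) h6
    rw [Real.log_pow, one_div, Real.log_inv] at h7
    push_cast at h7
    nlinarith

lemma SN.lint (h : SN N β) (hβ : 0 < β) {q : ℝ} (hq : 0 < q) (hqc : q ≤ cc / β) :
    ∫⁻ x, ENNReal.ofReal (N x ^ (-q)) ∂(G E) ≤
      ENNReal.ofReal (1 + Real.exp (40000 * q ^ 2 * β) + TT) := by
  have hc := h.cont
  have hb1 := h.beta_le
  obtain ⟨R, hR⟩ := h.lip
  have hmeas : ∀ k : ℕ, MeasurableSet {x | N x ≤ (1 / 200 : ℝ) ^ (k + 1)} := fun k =>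
    (isClosed_le (by fun_prop) continuous_const).measurableSet
  have hi : Integrable (fun x => Real.exp (- (200 * q * (N x - 1)))) (G E) := by
    have := ((hR.const_mul (200 * q)).neg.int_exp 0 1).const_mul (Real.exp (200 * q))
    refine this.congr (Filter.Eventually.of_forall fun g => ?_)
    simp only
    rw [← Real.exp_add, zero_add, one_smul]
    congr 1
    ring
  have hm2 : Measurable fun x => 1 + ENNReal.ofReal (Real.exp (-(200 * q * (N x - 1)))) := by
    fun_prop
  calc ∫⁻ x, ENNReal.ofReal (N x ^ (-q)) ∂(G E) ≤
      ∫⁻ x, (1 + ENNReal.ofReal (Real.exp (-(200 * q * (N x - 1)))) +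
      ∑' k : ℕ, {x | N x ≤ (1 / 200 : ℝ) ^ (k + 1)}.indicator (fun _ =>
        ENNReal.ofReal (Real.exp (q * (k + 2) * Real.log 200))) x) ∂(G E) := by
        apply lintegral_mono
        intro x
        have := pointwise (h.nonneg x) hq
        simp only [indicator, mem_ofPred_eq]
        exact this
    _ = 1 + ∫⁻ x, ENNReal.ofReal (Real.exp (-(200 * q * (N x - 1)))) ∂(G E) +
        ∑' k : ℕ, ENNReal.ofReal (Real.exp (q * (k + 2) * Real.log 200)) *
          (G E) {x | N x ≤ (1 / 200 : ℝ) ^ (k + 1)} := by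
        rw [lintegral_add_left hm2, lintegral_add_left measurable_const, lintegral_tsum]
        · simp only [lintegral_const, measure_univ, mul_one]
          congr 2
          ext k
          rw [lintegral_indicator_const (hmeas k)]
        · intro k
          exact (measurable_const.indicator (hmeas k)).aemeasurable
    _ ≤ ENNReal.ofReal 1 + ENNReal.ofReal (Real.exp (40000 * q ^ 2 * β)) + ENNReal.ofReal TT := by
        gcongr
        · simp
        · rw [← ofReal_integral_eq_lintegral_ofReal hi
            (Filter.Eventually.of_forall fun x => (Real.exp_pos _).le)]
          apply ENNReal.ofReal_le_ofReal
          refine (h.mgf (200 * q) (by positivity)).trans (le_of_eq ?_)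
          congr 1
          ring
        · rw [TT, ENNReal.ofReal_tsum_of_nonneg (fun k => by positivity) TT_sum]
          refine ENNReal.tsum_le_tsum fun k => ?_
          have h1 := h.small hβ (k + 1) 0
          simp only [sub_zero] at h1
          rw [measureReal_def] at h1
          have h2 := (ENNReal.le_ofReal_iff_toReal_le (measure_ne_top _ _) (Real.exp_pos _).le).2 h1
          refine (mul_le_mul_right h2 _).trans ?_
          rw [← ENNReal.ofReal_mul (Real.exp_pos _).le, ← Real.exp_nat_mul, ← Real.exp_add,
            ← Real.exp_add]
          apply ENNReal.ofReal_le_ofReal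
          apply Real.exp_le_exp.2
          have hl := log200
          have h3 : q * Real.log 200 ≤ 1 / (256 * β) := by
            calc q * Real.log 200 ≤ cc / β * Real.log 200 := by gcongr
              _ = 1 / (256 * β) := by unfold cc; field_simp
          have h4 : q * (k + 2) * Real.log 200 ≤ (2 * (k + 1)) * (1 / (256 * β)) := by
            calc q * (k + 2) * Real.log 200 = (k + 2) * (q * Real.log 200) := by ring
              _ ≤ (2 * (k + 1)) * (1 / (256 * β)) := by
                gcongr
                linarith
          have h5 : (2 * (k + 1 : ℝ)) * (1 / (256 * β)) - (k + 1) / (64 * β) =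
              - ((k + 1) / 128) * (1 / β) := by
            field_simp; ring
          have h6 : 1 ≤ 1 / β := by rw [le_div_iff₀ hβ]; linarith
          have h7 : ((k : ℝ) + 1) / 128 * 1 ≤ ((k : ℝ) + 1) / 128 * (1 / β) := by gcongr
          push_cast
          linarith
    _ = _ := by
        have := TT_nonneg
        rw [ENNReal.ofReal_add (by positivity) this, ENNReal.ofReal_add (by norm_num) (Real.exp_pos _).le]

lemma SN.negint (h : SN N β) (hβ : 0 < β) {q : ℝ} (hq : 0 < q) (hqc : q ≤ cc / β) :
    Integrable (fun x => N x ^ (-q)) (G E) := by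
  have hm := h.cont.measurable
  refine ⟨(hm.pow_const _).aestronglyMeasurable, ?_⟩
  rw [hasFiniteIntegral_iff_ofReal (Filter.Eventually.of_forall fun x => Real.rpow_nonneg (h.nonneg x) _)]
  exact (h.lint hβ hq hqc).trans_lt ENNReal.ofReal_lt_top

/-- absolute constant -/
noncomputable def DD : ℝ := Real.log (2 + TT)

lemma DD_nonneg : 0 ≤ DD := Real.log_nonneg (by linarith [TT_nonneg])

lemma SN.neg_le (h : SN N β) (hβ : 0 < β) {q : ℝ} (hq : 0 < q) (hqc : q ≤ cc / β) :
    ∫ x, N x ^ (-q) ∂(G E) ≤ Real.exp (DD + 40000 * q ^ 2 * β) := by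
  have hT := TT_nonneg
  have hnn : ∀ x, 0 ≤ N x ^ (-q) := fun x => Real.rpow_nonneg (h.nonneg x) _
  rw [integral_eq_lintegral_of_nonneg_ae (Filter.Eventually.of_forall hnn) (h.negint hβ hq hqc).1]
  have h1 := ENNReal.toReal_mono ENNReal.ofReal_ne_top (h.lint hβ hq hqc)
  rw [ENNReal.toReal_ofReal (by positivity)] at h1
  refine h1.trans ?_
  rw [Real.exp_add, DD, Real.exp_log (by linarith)]
  have : 1 ≤ Real.exp (40000 * q ^ 2 * β) := Real.one_le_exp (by positivity)
  nlinarith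

/-- the large constant -/
noncomputable def CC : ℝ := DD / cc + 40000

lemma CC_pos : 0 < CC := by
  have := DD_nonneg
  have := cc_pos
  unfold CC; positivity

lemma SN.root_le (h : SN N β) (hβ : 0 < β) {q : ℝ} (hq : 0 < q) (hqc : q ≤ cc / β) :
    (∫ x, N x ^ (-q) ∂(G E)) ^ (1 / q) ≤ Real.exp (DD / q + 40000 * q * β) := by
  have hnn : 0 ≤ ∫ x, N x ^ (-q) ∂(G E) := integral_nonneg fun x => Real.rpow_nonneg (h.nonneg x) _
  refine (Real.rpow_le_rpow hnn (h.neg_le hβ hq hqc) (by positivity)).trans (le_of_eq ?_)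
  rw [← Real.exp_mul]
  congr 1
  field_simp

lemma SN.root_mono (h : SN N β) (hβ : 0 < β) {q q1 : ℝ} (hq : 0 < q) (hqq : q ≤ q1)
    (hqc : q1 ≤ cc / β) :
    (∫ x, N x ^ (-q) ∂(G E)) ^ (1 / q) ≤ (∫ x, N x ^ (-q1) ∂(G E)) ^ (1 / q1) := by
  have hq1 : 0 < q1 := hq.trans_le hqq
  have hnn : ∀ q : ℝ, 0 ≤ ∫ x, N x ^ (-q) ∂(G E) := fun q =>
    integral_nonneg fun x => Real.rpow_nonneg (h.nonneg x) _
  have e : ∀ x, (N x ^ (-q1)) ^ (q / q1) = N x ^ (-q) := by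
    intro x
    rw [← Real.rpow_mul (h.nonneg x)]
    congr 1
    field_simp
  have hconc := Real.concaveOn_rpow (p := q / q1) (by positivity) ((div_le_one hq1).2 hqq)
  have hj := hconc.le_map_integral (μ := G E) (f := fun x => N x ^ (-q1))
    (by
      have : 0 ≤ q / q1 := by positivity
      exact (Real.continuous_rpow_const this).continuousOn) isClosed_Ici
    (Filter.Eventually.of_forall fun x => Real.rpow_nonneg (h.nonneg x) _)
    (h.negint hβ hq1 hqc)
    (by
      refine (h.negint hβ hq (hqq.trans hqc)).congr (Filter.Eventually.of_forall fun x => ?_)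
      simp only [Function.comp]
      exact (e x).symm)
  simp_rw [e] at hj
  refine (Real.rpow_le_rpow (hnn q) hj (by positivity)).trans (le_of_eq ?_)
  rw [← Real.rpow_mul (hnn q1)]
  congr 1
  field_simp

theorem SN.final (h : SN N β) (hβ : 0 < β) {q : ℝ} (hq : 0 < q) (hqc : q ≤ cc / β) :
    (∫ x, N x ^ (-q) ∂(G E)) ^ (1 / q) ≤ Real.exp (CC * max (√β) (q * β)) := by
  have hD := DD_nonneg
  have hc := cc_pos
  have hc1 := cc_le
  have hb1 := h.beta_le
  have hs : 0 < √β := by positivity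
  have hss : √β * √β = β := Real.mul_self_sqrt hβ.le
  have hs1 : √β ≤ 1 := by rw [Real.sqrt_le_one]; exact hb1
  have hDc : DD ≤ DD / cc := by rw [le_div_iff₀ hc]; nlinarith
  rcases le_or_gt 1 (q * √β) with h1 | h1
  · refine (h.root_le hβ hq hqc).trans (Real.exp_le_exp.2 ?_)
    have h2 : DD / q ≤ DD / cc * √β := by
      have : 1 / q ≤ √β := by rw [div_le_iff₀ hq]; linarith
      calc DD / q = DD * (1 / q) := by ring
        _ ≤ DD / cc * √β := by gcongr
    have h3 : DD / cc * √β ≤ DD / cc * max (√β) (q * β) := by gcongr; exact le_max_left _ _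
    have h4 := le_max_right (√β) (q * β)
    unfold CC
    linarith
  · set q1 := min (1 / √β) (cc / β) with hq1d
    have hq1 : 0 < q1 := by positivity
    have hqq : q ≤ q1 := le_min (by rw [le_div_iff₀ hs]; exact h1.le) hqc
    refine (h.root_mono hβ hq hqq (min_le_right _ _)).trans
      ((h.root_le hβ hq1 (min_le_right _ _)).trans (Real.exp_le_exp.2 ?_))
    have h2 : 1 / q1 ≤ √β / cc := by
      rw [one_div_le hq1 (by positivity), one_div_div]
      apply le_min
      · gcongr
      · gcongr
        nlinarith
    have h3 : q1 * β ≤ √β := by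
      calc q1 * β ≤ 1 / √β * β := by gcongr; exact min_le_left _ _
        _ = √β := by nth_rewrite 2 [← hss]; field_simp
    have h4 : DD / q1 ≤ DD / cc * √β := by
      calc DD / q1 = DD * (1 / q1) := by ring
        _ ≤ DD * (√β / cc) := by gcongr
        _ = _ := by ring
    have h5 : CC * √β ≤ CC * max (√β) (q * β) := by
      have := CC_pos
      gcongr
      exact le_max_left _ _
    refine le_trans ?_ h5
    unfold CC
    linarith

end SNM

namespace SNM

set_option linter.unusedSectionVars false

variable {E : Type*} [NormedAddCommGroup E] [InnerProductSpace ℝ E] [FiniteDimensional ℝ E]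
  [MeasurableSpace E] [BorelSpace E]

/-- radial factor -/
noncomputable def JJ (E : Type*) [NormedAddCommGroup E] [InnerProductSpace ℝ E] (p : ℝ) : ℝ :=
  ∫ r : Ioi (0 : ℝ), (r : ℝ) ^ p * ((2 * π) ^ (-(Module.finrank ℝ E / 2 : ℝ)) *
    Real.exp (-(1/2) * (r : ℝ) ^ 2)) ∂(Measure.volumeIoiPow (Module.finrank ℝ E - 1))

lemma polar [Nontrivial E] (f : E → ℝ) (p : ℝ) (hf : ∀ r : ℝ, 0 < r → ∀ x, f (r • x) = r ^ p * f x) :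
    ∫ x, f x ∂(G E) = (∫ θ, f θ ∂((volume : Measure E).toSphere)) * JJ E p := by
  rw [integral_G]
  have mp := (volume : Measure E).measurePreserving_homeomorphUnitSphereProd
  calc ∫ x, rho E x * f x = ∫ x : ({(0 : E)}ᶜ : Set E), rho E x * f x ∂((volume : Measure E).comap (↑)) := by
        rw [integral_subtype_comap (measurableSet_singleton _).compl (fun x => rho E x * f x),
          restrict_compl_singleton]
    _ = ∫ x : ({(0 : E)}ᶜ : Set E), (fun z : Metric.sphere (0 : E) 1 × Ioi (0 : ℝ) =>
        f z.1 * ((z.2 : ℝ) ^ p * ((2 * π) ^ (-(Module.finrank ℝ E / 2 : ℝ)) *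
        Real.exp (-(1/2) * (z.2 : ℝ) ^ 2)))) (homeomorphUnitSphereProd E x)
          ∂((volume : Measure E).comap (↑)) := by
        congr 1
        ext x
        have hx : 0 < ‖(x : E)‖ := norm_pos_iff.2 x.2
        have e : (x : E) = ‖(x : E)‖ • (‖(x : E)‖⁻¹ • (x : E)) := by
          rw [smul_smul, mul_inv_cancel₀ hx.ne', one_smul]
        have e2 : f x = ‖(x : E)‖ ^ p * f (‖(x : E)‖⁻¹ • (x : E)) := by
          conv_lhs => rw [e]
          exact hf _ hx _
        rw [e2]
        simp [rho]
        ring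
    _ = ∫ z, f z.1 * ((z.2 : ℝ) ^ p * ((2 * π) ^ (-(Module.finrank ℝ E / 2 : ℝ)) *
        Real.exp (-(1/2) * (z.2 : ℝ) ^ 2))) ∂((volume : Measure E).toSphere.prod
          (Measure.volumeIoiPow (Module.finrank ℝ E - 1))) := by
        exact mp.integral_comp (Homeomorph.measurableEmbedding _)
          (fun z : Metric.sphere (0 : E) 1 × Ioi (0 : ℝ) =>
            f z.1 * ((z.2 : ℝ) ^ p * ((2 * π) ^ (-(Module.finrank ℝ E / 2 : ℝ)) *
              Real.exp (-(1/2) * (z.2 : ℝ) ^ 2))))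
    _ = _ := by
        rw [integral_prod_mul (f := fun θ : Metric.sphere (0 : E) 1 => f θ)
          (g := fun r : Ioi (0 : ℝ) => (r : ℝ) ^ p * ((2 * π) ^ (-(Module.finrank ℝ E / 2 : ℝ)) *
            Real.exp (-(1/2) * (r : ℝ) ^ 2)))]
        rfl

lemma polar2 [Nontrivial E] (f : E → ℝ) (p : ℝ)
    (hf : ∀ r : ℝ, 0 < r → ∀ x, f (r • x) = r ^ p * f x) :
    ∫ x, f x ∂(G E) = (∫ x, ‖x‖ ^ p ∂(G E)) *
      (((volume : Measure E).toSphere.real univ)⁻¹ * ∫ θ, f θ ∂((volume : Measure E).toSphere)) := by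
  have h1 := polar f p hf
  have h2 := polar (E := E) (fun x => ‖x‖ ^ p) p (by
    intro r hr x
    rw [norm_smul, Real.norm_eq_abs, abs_of_pos hr, Real.mul_rpow hr.le (norm_nonneg _)])
  have h3 : ∫ θ : Metric.sphere (0 : E) 1, ‖(θ : E)‖ ^ p ∂((volume : Measure E).toSphere) =
      (volume : Measure E).toSphere.real univ := by
    have : ∀ θ : Metric.sphere (0 : E) 1, ‖(θ : E)‖ ^ p = 1 := by
      intro θ
      rw [norm_eq_of_mem_sphere, Real.one_rpow]
    simp_rw [this]
    simp
  rw [h3] at h2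
  have hS : (volume : Measure E).toSphere.real univ ≠ 0 := by
    rw [Ne, measureReal_eq_zero_iff, Measure.measure_univ_eq_zero]
    exact Measure.toSphere_ne_zero _
  rw [h1, h2]
  field_simp

lemma jensen_neg [Nontrivial E] {q : ℝ} (hq : 0 < q)
    (hi : Integrable (fun x : E => ‖x‖ ^ (-q)) (G E)) :
    0 < ∫ x : E, ‖x‖ ∂(G E) ∧
    1 ≤ (∫ x : E, ‖x‖ ^ (-q) ∂(G E)) * (∫ x : E, ‖x‖ ∂(G E)) ^ q := by
  have hi1 : Integrable (fun x : E => ‖x‖) (G E) := by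
    refine integrable_of_growth (by fun_prop) 1 1 fun x => ?_
    rw [abs_of_nonneg (norm_nonneg _), one_mul, one_mul]
    exact le_exp_self _
  have hne : ∀ᵐ x : E ∂(G E), x ≠ 0 := by
    have hac : G E ≪ (volume : Measure E) := by
      rw [G_density]; exact withDensity_absolutelyContinuous _ _
    have h0 : ∀ᵐ x : E ∂(volume : Measure E), x ≠ 0 := by
      rw [ae_iff]
      simp
    exact hac.ae_le h0
  have hc : 0 < ∫ x : E, ‖x‖ ∂(G E) := by
    rw [integral_pos_iff_support_of_nonneg (fun x => norm_nonneg _) hi1]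
    have : Function.support (fun x : E => ‖x‖) = {x | x ≠ 0} := by
      ext x; simp
    have h1 : (G E) {x | x ≠ 0} = 1 :=
      (mem_ae_iff_prob_eq_one (measurableSet_singleton (0 : E)).compl).1 hne
    rw [this, h1]
    simp
  refine ⟨hc, ?_⟩
  set c := ∫ x : E, ‖x‖ ∂(G E) with hcd
  have h1 : ∫ x : E, (1 - q * (c⁻¹ * ‖x‖ - 1)) ∂(G E) = 1 := by
    rw [integral_sub (integrable_const _) ((isub (hi1.const_mul _) (integrable_const _)).const_mul _),
      integral_const_mul, integral_sub (hi1.const_mul _) (integrable_const _), integral_const_mul,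
      ← hcd, inv_mul_cancel₀ hc.ne']
    simp
  rw [← h1, ← integral_mul_const]
  refine integral_mono_ae (isub (integrable_const _)
    ((isub (hi1.const_mul _) (integrable_const _)).const_mul _)) (hi.mul_const _) ?_
  filter_upwards [hne] with x hx
  have hx' : 0 < ‖x‖ := norm_pos_iff.2 hx
  have ht : 0 < c⁻¹ * ‖x‖ := by positivity
  have e : ‖x‖ ^ (-q) * c ^ q = (c⁻¹ * ‖x‖) ^ (-q) := by
    rw [Real.mul_rpow (by positivity) hx'.le, Real.inv_rpow hc.le, Real.rpow_neg hc.le, inv_inv]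
    ring
  rw [e, Real.rpow_def_of_pos ht]
  have h2 := Real.add_one_le_exp (Real.log (c⁻¹ * ‖x‖) * -q)
  have h3 := Real.log_le_sub_one_of_pos ht
  nlinarith

end SNM

namespace SNM

set_option linter.unusedSectionVars false

variable {E : Type*} [NormedAddCommGroup E] [InnerProductSpace ℝ E] [FiniteDimensional ℝ E]
  [MeasurableSpace E] [BorelSpace E]

lemma supp_neg {A : Set E} (hA : IsCompact A) (hne : A.Nonempty) (hs : A = -A) (x : E) :
    supp A (-x) = supp A x := by
  have key : ∀ y : E, supp A (-y) ≤ supp A y := by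
    intro y
    apply supp_le hne
    intro a ha
    have ha' : -a ∈ A := by rw [hs] at ha; exact ha
    have := le_supp hA y ha'
    rwa [inner_neg_left, ← inner_neg_right] at this
  refine le_antisymm (key x) ?_
  have := key (-x)
  rwa [neg_neg] at this

lemma supp_nonneg {A : Set E} (hA : IsCompact A) (hne : A.Nonempty) (hs : A = -A) (x : E) :
    0 ≤ supp A x := by
  obtain ⟨a, ha⟩ := hne
  have ha' : -a ∈ A := by rw [hs] at ha; exact ha
  have h1 := le_supp hA x ha
  have h2 := le_supp hA x ha'
  rw [inner_neg_left] at h2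
  linarith

lemma supp_pos_homog {A : Set E} (hA : IsCompact A) (hne : A.Nonempty) {t : ℝ} (ht : 0 < t)
    (x : E) : supp A (t • x) = t * supp A x := by
  refine le_antisymm (supp_smul hA hne ht.le x) ?_
  have := supp_smul hA hne (inv_nonneg.2 ht.le) (t • x)
  rw [smul_smul, inv_mul_cancel₀ ht.ne', one_smul] at this
  calc t * supp A x ≤ t * (t⁻¹ * supp A (t • x)) := mul_le_mul_of_nonneg_left this ht.le
    _ = _ := by field_simp

lemma supp_zero {A : Set E} (hA : IsCompact A) (hne : A.Nonempty) : supp A (0 : E) = 0 := by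
  obtain ⟨a, ha⟩ := hne
  refine le_antisymm (supp_le ⟨a, ha⟩ fun b hb => by simp) ?_
  have := le_supp hA (0 : E) ha
  simpa using this

lemma supp_homog {A : Set E} (hA : IsCompact A) (hne : A.Nonempty) (hs : A = -A) (t : ℝ)
    (x : E) : supp A (t • x) = |t| * supp A x := by
  rcases lt_trichotomy t 0 with h | h | h
  · rw [abs_of_neg h, ← supp_pos_homog hA hne (neg_pos.2 h), neg_smul, supp_neg hA hne hs]
  · subst h
    simp [supp_zero hA hne]
  · rw [abs_of_pos h, supp_pos_homog hA hne h]

lemma supp_pos {A : Set E} (hA : IsCompact A) (hs : A = -A) (hi : (interior A).Nonempty)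
    {x : E} (hx : x ≠ 0) : 0 < supp A x := by
  obtain ⟨a, ha⟩ := hi
  obtain ⟨ε, hε, hb⟩ := Metric.isOpen_iff.1 isOpen_interior a ha
  have hxn : 0 < ‖x‖ := norm_pos_iff.2 hx
  have haA := interior_subset ha
  have ha' : -a ∈ A := by rw [hs] at haA; exact haA
  have h1 : a + (ε / 2 / ‖x‖) • x ∈ A := by
    apply interior_subset
    apply hb
    rw [Metric.mem_ball, dist_eq_norm, add_sub_cancel_left, norm_smul, Real.norm_eq_abs,
      abs_of_pos (by positivity), div_mul_cancel₀ _ hxn.ne']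
    linarith
  have h2 := le_supp hA x h1
  have h3 := le_supp hA x ha'
  rw [inner_add_left, real_inner_smul_left, real_inner_self_eq_norm_sq] at h2
  rw [inner_neg_left] at h3
  have : 0 < ε / 2 / ‖x‖ * ‖x‖ ^ 2 := by positivity
  linarith

lemma mkSN {A : Set E} (hA : IsCompact A) (hc : Convex ℝ A) (hne : A.Nonempty) (hs : A = -A)
    {m V : ℝ} (hm : m = ∫ g, supp A g ∂(G E)) (hm0 : 0 < m)
    (hV : V = ∫ g, (supp A g - m) ^ 2 ∂(G E)) :
    SN (fun x => m⁻¹ * supp A x) (V / m ^ 2) := by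
  obtain ⟨R, hR⟩ := hA.isBounded.exists_norm_le
  have hlip := supp_lip hA hne hR
  have e : ∀ x, m⁻¹ * supp A x - 1 = m⁻¹ * (supp A x - m) := by
    intro x; field_simp
  refine ⟨?_, ?_, ?_, ⟨_, hlip.const_mul m⁻¹⟩, ?_, ?_, ?_⟩
  · intro x
    exact mul_nonneg (inv_nonneg.2 hm0.le) (supp_nonneg hA hne hs x)
  · intro x y
    rw [← mul_add]
    exact mul_le_mul_of_nonneg_left (supp_add hA hne x y) (inv_nonneg.2 hm0.le)
  · intro t x
    simp only [supp_homog hA hne hs]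
    ring
  · rw [integral_const_mul, ← hm, inv_mul_cancel₀ hm0.ne']
  · simp_rw [e, mul_pow]
    rw [integral_const_mul, ← hV]
    field_simp
  · intro l hl
    have := lemmaA hA hc hne (supp_nonneg hA hne hs) hm hm0 hV (l := l / m) (by positivity)
    have e2 : ∀ x, -(l * (m⁻¹ * supp A x - 1)) = -(l / m * (supp A x - m)) := by
      intro x; field_simp
    simp_rw [e2]
    refine this.trans (le_of_eq ?_)
    congr 1
    field_simp

theorem core [Nontrivial E] {A : Set E} (hA : IsCompact A) (hc : Convex ℝ A) (hs : A = -A)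
    (hi : (interior A).Nonempty)
    {m V : ℝ} (hm : m = ∫ g, supp A g ∂(G E)) (hm0 : 0 < m)
    (hV : V = ∫ g, (supp A g - m) ^ 2 ∂(G E)) (hβ : 0 < V / m ^ 2) {q : ℝ} (hq : 0 < q)
    (hqc : q ≤ cc / (V / m ^ 2)) :
    (((volume : Measure E).toSphere.real univ)⁻¹ * ∫ θ, supp A θ ∂((volume : Measure E).toSphere)) *
      (((volume : Measure E).toSphere.real univ)⁻¹ *
        ∫ θ, supp A θ ^ (-q) ∂((volume : Measure E).toSphere)) ^ (1 / q) ≤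
      m * (∫ x, supp A x ^ (-q) ∂(G E)) ^ (1 / q) ∧
    m * (∫ x, supp A x ^ (-q) ∂(G E)) ^ (1 / q) ≤
      Real.exp (CC * max (√(V / m ^ 2)) (q * (V / m ^ 2))) := by
  have hne : A.Nonempty := hi.mono interior_subset
  have hsn := mkSN hA hc hne hs hm hm0 hV
  have hnn := supp_nonneg hA hne hs
  have hint := hsn.negint hβ hq hqc
  have e1 : ∀ x, (m⁻¹ * supp A x) ^ (-q) = m ^ q * supp A x ^ (-q) := by
    intro x
    rw [Real.mul_rpow (by positivity) (hnn x), Real.inv_rpow hm0.le, Real.rpow_neg hm0.le, inv_inv]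
  have hint2 : Integrable (fun x => supp A x ^ (-q)) (G E) := by
    have := hint.const_mul (m ^ q)⁻¹
    refine this.congr (Filter.Eventually.of_forall fun x => ?_)
    simp only [e1]
    have : m ^ q ≠ 0 := by positivity
    field_simp
  have hInn : 0 ≤ ∫ x, supp A x ^ (-q) ∂(G E) :=
    integral_nonneg fun x => Real.rpow_nonneg (hnn x) _
  constructor
  · obtain ⟨R₀, hR₀⟩ := hA.isBounded.exists_norm_le
    set R := max R₀ 1 with hRd
    have hR : ∀ a ∈ A, ‖a‖ ≤ R := fun a ha => (hR₀ a ha).trans (le_max_left _ _)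
    have hR1 : 0 < R := lt_of_lt_of_le one_pos (le_max_right _ _)
    have hlip := supp_lip hA hne hR
    have hup : ∀ x, supp A x ≤ R * ‖x‖ := by
      intro x
      have := hlip x 0
      rw [supp_zero hA hne, sub_zero, sub_zero] at this
      exact (le_abs_self _).trans this
    have hin : Integrable (fun x : E => ‖x‖ ^ (-q)) (G E) := by
      refine (hint2.const_mul (R ^ q)).mono'
        (measurable_norm.pow_const _).aestronglyMeasurable (Filter.Eventually.of_forall fun x => ?_)
      rw [Real.norm_eq_abs, abs_of_nonneg (Real.rpow_nonneg (norm_nonneg _) _)]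
      rcases eq_or_ne x 0 with hx | hx
      · subst hx
        rw [norm_zero, Real.zero_rpow (by linarith)]
        exact mul_nonneg (by positivity) (Real.rpow_nonneg (hnn _) _)
      · have hp := supp_pos hA hs hi hx
        have h1 := Real.rpow_le_rpow_of_nonpos hp (hup x) (neg_nonpos.2 hq.le)
        rw [Real.mul_rpow hR1.le (norm_nonneg _), Real.rpow_neg hR1.le] at h1
        have h2 : 0 < R ^ q := by positivity
        calc ‖x‖ ^ (-q) = R ^ q * ((R ^ q)⁻¹ * ‖x‖ ^ (-q)) := by field_simp
          _ ≤ _ := mul_le_mul_of_nonneg_left h1 h2.le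
    obtain ⟨c1, hj⟩ := jensen_neg hq hin
    have p1 := polar2 (supp A) 1 (by
      intro r hr x
      rw [supp_pos_homog hA hne hr, Real.rpow_one])
    have p2 := polar2 (fun x => supp A x ^ (-q)) (-q) (by
      intro r hr x
      rw [supp_pos_homog hA hne hr, Real.mul_rpow hr.le (hnn x)])
    simp only [Real.rpow_one] at p1
    rw [← hm] at p1
    have hw : 0 ≤ ((volume : Measure E).toSphere.real univ)⁻¹ *
        ∫ θ, supp A θ ∂((volume : Measure E).toSphere) :=
      mul_nonneg (by positivity) (integral_nonneg fun θ => hnn _)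
    have hW : 0 ≤ ((volume : Measure E).toSphere.real univ)⁻¹ *
        ∫ θ, supp A θ ^ (-q) ∂((volume : Measure E).toSphere) :=
      mul_nonneg (by positivity) (integral_nonneg fun θ => Real.rpow_nonneg (hnn _) _)
    have hc2 : 0 ≤ ∫ x : E, ‖x‖ ^ (-q) ∂(G E) :=
      integral_nonneg fun x => Real.rpow_nonneg (norm_nonneg _) _
    rw [p2, p1]
    generalize ((volume : Measure E).toSphere.real univ)⁻¹ *
        ∫ θ, supp A θ ∂((volume : Measure E).toSphere) = w at hw ⊢
    generalize ((volume : Measure E).toSphere.real univ)⁻¹ *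
        ∫ θ, supp A θ ^ (-q) ∂((volume : Measure E).toSphere) = W at hW ⊢
    generalize ∫ x : E, ‖x‖ ^ (-q) ∂(G E) = b at hj hc2 ⊢
    generalize ∫ x : E, ‖x‖ ∂(G E) = a at hj c1 ⊢
    rw [Real.mul_rpow hc2 hW]
    have h1 : 1 ≤ (b * a ^ q) ^ (1 / q) := Real.one_le_rpow hj (by positivity)
    rw [Real.mul_rpow hc2 (by positivity), ← Real.rpow_mul c1.le, mul_one_div_cancel hq.ne',
      Real.rpow_one] at h1
    have h2 : 0 ≤ w * W ^ (1 / q) := mul_nonneg hw (Real.rpow_nonneg hW _)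
    calc w * W ^ (1 / q) ≤ (b ^ (1 / q) * a) * (w * W ^ (1 / q)) := le_mul_of_one_le_left h2 h1
      _ = _ := by ring
  · refine le_trans (le_of_eq ?_) (hsn.final hβ hq hqc)
    simp_rw [e1]
    rw [integral_const_mul, Real.mul_rpow (by positivity) hInn, ← Real.rpow_mul hm0.le,
      mul_one_div_cancel hq.ne', Real.rpow_one]

end SNM

namespace SNM

lemma std_eq (n : ℕ) : _root_.stdGaussian n = G (EuclideanSpace ℝ (Fin n)) := by
  unfold _root_.stdGaussian G
  rw [← map_pi_eq_stdGaussian]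
  rfl

lemma unif_int (n : ℕ) (f : EuclideanSpace ℝ (Fin n) → ℝ) :
    ∫ θ, f θ ∂(uniformSphere n) =
      ((volume : Measure (EuclideanSpace ℝ (Fin n))).toSphere.real univ)⁻¹ *
        ∫ θ, f θ ∂((volume : Measure (EuclideanSpace ℝ (Fin n))).toSphere) := by
  unfold uniformSphere
  rw [(MeasurableEmbedding.subtype_coe Metric.isClosed_sphere.measurableSet).integral_map,
    integral_smul_measure, ENNReal.toReal_inv]
  rfl

end SNM

/-- There are absolute constants `c, C > 0` such that for every
symmetric convex body `A ⊆ ℝⁿ` and every `0 < q < c/β_*(A)`: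
`w(A)/w_{−q}(A) ≤ E[h_A(Z)]/(E[h_A(Z)^{−q}])^{−1/q} ≤ exp(C max{√β_*(A), q β_*(A)})`. -/
theorem stability_negative_moments :
    ∃ c C : ℝ, 0 < c ∧ 0 < C ∧
      ∀ (n : ℕ) (A : Set (EuclideanSpace ℝ (Fin n))),
        IsCompact A → Convex ℝ A → A = -A → (interior A).Nonempty →
      ∀ q : ℝ, 0 < q → q < c / betaStar A →
        meanWidth A / meanWidthNeg q A ≤
          (∫ x, suppFn A x ∂stdGaussian n) /
            (∫ x, suppFn A x ^ (-q) ∂stdGaussian n) ^ (-(1 : ℝ) / q) ∧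
        (∫ x, suppFn A x ∂stdGaussian n) /
            (∫ x, suppFn A x ^ (-q) ∂stdGaussian n) ^ (-(1 : ℝ) / q) ≤
          Real.exp (C * max (Real.sqrt (betaStar A)) (q * betaStar A)) := by
  refine ⟨SNM.cc, SNM.CC, SNM.cc_pos, SNM.CC_pos, ?_⟩
  intro n A hA hc hs hi q hq hqc
  have hne : A.Nonempty := hi.mono interior_subset
  have hsup : suppFn A = SNM.supp A := rfl
  have hG : stdGaussian n = SNM.G (EuclideanSpace ℝ (Fin n)) := SNM.std_eq n
  have hnn := SNM.supp_nonneg hA hne hs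
  obtain ⟨R, hR⟩ := hA.isBounded.exists_norm_le
  have hcont := (SNM.supp_lip hA hne hR).cont
  have hmw : meanWidth A = _ := SNM.unif_int n (suppFn A)
  have hmwn : meanWidthNeg q A = (_ : ℝ) ^ (-(1 : ℝ) / q) :=
    congrArg (fun t : ℝ => t ^ (-(1 : ℝ) / q)) (SNM.unif_int n (fun θ => suppFn A θ ^ (-q)))
  have hbs : betaStar A = (∫ x, (SNM.supp A x - ∫ y, SNM.supp A y ∂(SNM.G _)) ^ 2 ∂(SNM.G _)) /
      (∫ y, SNM.supp A y ∂(SNM.G _)) ^ 2 := by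
    unfold betaStar
    rw [hG, hsup, variance_eq_integral hcont.measurable.aemeasurable]
  rw [hmw, hmwn]
  rw [hbs] at hqc ⊢
  rw [hG, hsup]
  set m := ∫ y, SNM.supp A y ∂(SNM.G (EuclideanSpace ℝ (Fin n))) with hm
  set V := ∫ x, (SNM.supp A x - m) ^ 2 ∂(SNM.G (EuclideanSpace ℝ (Fin n))) with hV
  have hV0 : 0 ≤ V := integral_nonneg fun x => sq_nonneg _
  have hb0 : V / m ^ 2 ≠ 0 := by
    intro h
    rw [h, div_zero] at hqc
    linarith
  have hb : 0 < V / m ^ 2 := lt_of_le_of_ne (div_nonneg hV0 (sq_nonneg m)) (Ne.symm hb0)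
  have hm1 : m ≠ 0 := by
    intro h
    apply hb0
    rw [h]
    simp
  have hm0 : 0 < m := lt_of_le_of_ne (integral_nonneg hnn) (Ne.symm hm1)
  have hnt : Nontrivial (EuclideanSpace ℝ (Fin n)) := by
    by_contra hcon
    rw [not_nontrivial_iff_subsingleton] at hcon
    apply hm1
    have : ∀ y, SNM.supp A y = 0 := by
      intro y
      rw [Subsingleton.elim y 0, SNM.supp_zero hA hne]
    rw [hm]
    simp [this]
  have key := SNM.core hA hc hs hi hm hm0 hV hb hq hqc.le
  have conv : ∀ a b : ℝ, 0 ≤ b → a / b ^ (-(1 : ℝ) / q) = a * b ^ (1 / q) := by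
    intro a b hb
    rw [neg_div, Real.rpow_neg hb, div_inv_eq_mul]
  rw [conv _ _ (mul_nonneg (by positivity) (integral_nonneg fun θ => Real.rpow_nonneg (hnn _) _)),
    conv _ _ (integral_nonneg fun θ => Real.rpow_nonneg (hnn _) _)]
  exact key
end

section
/- Let μ be a log-concave probability measure on ℝⁿ, let ψ : ℝⁿ → ℝ be convex, and set F(t) = μ({z : ψ(z) ≤ t}). Then: (a) F is log-concave, i.e. F((1−λ)t + λs) ≥ F(t)^{1−λ}·F(s)^λ for all t, s ∈ ℝ and 0 < λ < 1; (b) if moreover ψ is a seminorm (positively homogeneous with ψ(λv) = |λ|ψ(v), and subadditive), then 1 − F((1−λ)t − λs) ≥ (1 − F(t))^{1−λ}·F(s)^λ for all t, s > 0 and 0 < λ < t/(t+s). -/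
open MeasureTheory ProbabilityTheory Real Set
open scoped ENNReal Pointwise

/-- A Borel probability measure on `ℝⁿ` is log-concave if
`μ(λA + (1−λ)B) ≥ μ(A)^λ μ(B)^{1−λ}` for all Borel sets `A, B` and `λ ∈ (0,1)`,
where `λA + (1−λ)B` is the Minkowski combination. -/
def IsLogConcave {n : ℕ} (μ : Measure (EuclideanSpace ℝ (Fin n))) : Prop :=
  ∀ A B : Set (EuclideanSpace ℝ (Fin n)), MeasurableSet A → MeasurableSet B →
    ∀ l : ℝ, 0 < l → l < 1 →
      μ A ^ l * μ B ^ (1 - l) ≤ μ (l • A + (1 - l) • B)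

/-- Let `μ` be log-concave on `ℝⁿ`, `ψ : ℝⁿ → ℝ` convex and
`F(t) = μ(ψ ≤ t)`. Then (a) `F` is log-concave; and (b) if `ψ` is a seminorm then
`1 − F((1−λ)t − λs) ≥ (1 − F(t))^{1−λ} F(s)^λ` for `t, s > 0`, `0 < λ < t/(t+s)`. -/
theorem cdf_logconcave_of_convex
    (n : ℕ) (μ : Measure (EuclideanSpace ℝ (Fin n))) [IsProbabilityMeasure μ]
    (hμ : IsLogConcave μ)
    (ψ : EuclideanSpace ℝ (Fin n) → ℝ) (hψ : ConvexOn ℝ Set.univ ψ) :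
    (∀ t s l : ℝ, 0 < l → l < 1 →
      μ {z | ψ z ≤ t} ^ (1 - l) * μ {z | ψ z ≤ s} ^ l ≤
        μ {z | ψ z ≤ (1 - l) * t + l * s}) ∧
    ((∀ (a : ℝ) (v), ψ (a • v) = |a| * ψ v) → (∀ u v, ψ (u + v) ≤ ψ u + ψ v) →
      ∀ t s l : ℝ, 0 < t → 0 < s → 0 < l → l < t / (t + s) →
        (1 - μ {z | ψ z ≤ t}) ^ (1 - l) * μ {z | ψ z ≤ s} ^ l ≤
          1 - μ {z | ψ z ≤ (1 - l) * t - l * s}) := by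
  have hc : Continuous ψ := by
    have h := ConvexOn.continuousOn isOpen_univ hψ
    exact continuousOn_univ.mp h
  have hm : ∀ t : ℝ, MeasurableSet {z | ψ z ≤ t} := fun t =>
    (isClosed_le hc continuous_const).measurableSet
  refine ⟨?_, ?_⟩
  · intro t s l hl hl1
    have h := hμ _ _ (hm s) (hm t) l hl hl1
    rw [mul_comm]
    refine h.trans (measure_mono ?_)
    rintro _ ⟨_, ⟨x, hx, rfl⟩, _, ⟨y, hy, rfl⟩, rfl⟩
    have h1 := hψ.2 (mem_univ x) (mem_univ y) hl.le (sub_nonneg.2 hl1.le) (by ring)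
    simp only [mem_setOf_eq, smul_eq_mul] at *
    have h2 := mul_le_mul_of_nonneg_left hx hl.le
    have h3 := mul_le_mul_of_nonneg_left hy (sub_nonneg.2 hl1.le)
    linarith
  · intro hs hadd t s l ht hs0 hl hl2
    have hl1 : l < 1 := hl2.trans_le (by rw [div_le_one (by positivity)]; linarith)
    rw [← prob_compl_eq_one_sub (hm t), ← prob_compl_eq_one_sub (hm _), mul_comm]
    have h := hμ _ _ (hm s) (hm t).compl l hl hl1
    refine h.trans (measure_mono ?_)
    rintro _ ⟨_, ⟨x, hx, rfl⟩, _, ⟨y, hy, rfl⟩, rfl⟩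
    have h1 := hadd (l • x + (1 - l) • y) ((-l) • x)
    have e : l • x + (1 - l) • y + (-l) • x = (1 - l) • y := by module
    rw [e, hs, hs, abs_neg, abs_of_pos hl, abs_of_pos (sub_pos.2 hl1)] at h1
    simp only [mem_compl_iff, mem_setOf_eq, not_le] at *
    have h2 := mul_le_mul_of_nonneg_left hx hl.le
    have h3 := mul_lt_mul_of_pos_left hy (sub_pos.2 hl1)
    linarith
end

section
/- Let μ be a log-concave probability measure on ℝⁿ and let ψ : ℝⁿ → ℝ be a convex map with ψ ∈ L¹(μ). Let F(t) = μ({z : ψ(z) ≤ t}), let m be a median of ψ with respect to μ (so F(m) = 1/2), and suppose F is differentiable at m with derivative f(m). Then f(m) ≥ 1/(32·‖(ψ−m)₊‖_{L¹(μ)}), where (ψ−m)₊ = max{ψ−m, 0}. -/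
open MeasureTheory ProbabilityTheory Real Set
open scoped ENNReal Pointwise

/-- Let `μ` be log-concave on `ℝⁿ`, `ψ` convex and `μ`-integrable,
`F(t) = μ(ψ ≤ t)`, `m` a median of `ψ` (so `F(m) = 1/2`), and suppose `F` is
differentiable at `m` with derivative `f(m)`. Then
`f(m) ≥ 1/(32 ‖(ψ−m)₊‖_{L¹(μ)})`. -/
theorem cdf_deriv_at_median_ge
    (n : ℕ) (μ : Measure (EuclideanSpace ℝ (Fin n))) [IsProbabilityMeasure μ]
    (hμ : IsLogConcave μ)
    (ψ : EuclideanSpace ℝ (Fin n) → ℝ) (hψ : ConvexOn ℝ Set.univ ψ)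
    (hint : Integrable ψ μ)
    (m fm : ℝ)
    (hmed : μ {z | ψ z ≤ m} = 1 / 2)
    (hmed' : (1 : ENNReal) / 2 ≤ μ {z | m ≤ ψ z})
    (hderiv : HasDerivAt (fun t => (μ {z | ψ z ≤ t}).toReal) fm m) :
    1 / (32 * ∫ x, max (ψ x - m) 0 ∂μ) ≤ fm := by
  have hcont : Continuous ψ := by
    rw [← continuousOn_univ]
    exact hψ.continuousOn isOpen_univ
  have hmeas : ∀ t, MeasurableSet {z | ψ z ≤ t} := fun t =>
    measurableSet_le hcont.measurable measurable_const
  have hi : Integrable (fun x => max (ψ x - m) 0) μ :=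
    (hint.sub (integrable_const m)).pos_part
  have hnn : 0 ≤ fun x => max (ψ x - m) 0 := fun x => le_max_right _ _
  set a := ∫ x, max (ψ x - m) 0 ∂μ with ha
  have ha0 : 0 ≤ a := integral_nonneg hnn
  have hapos : 0 < a := by
    rcases ha0.lt_or_eq with h | h
    · exact h
    exfalso
    have h0 := (integral_eq_zero_iff_of_nonneg hnn hi).1 h.symm
    have h1 : ∀ᵐ x ∂μ, ψ x ≤ m := by
      filter_upwards [h0] with x hx
      have : max (ψ x - m) 0 = 0 := hx
      have := le_max_left (ψ x - m) 0
      linarith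
    have h2 : μ {z | ψ z ≤ m} = 1 := (prob_compl_eq_zero_iff (hmeas m)).1 h1
    rw [hmed] at h2
    have := congrArg ENNReal.toReal h2
    norm_num at this
  have hFm : (μ {z | ψ z ≤ m}).toReal = 1 / 2 := by rw [hmed]; norm_num
  have hmk : 3 / 4 ≤ (μ {z | ψ z ≤ m + 4 * a}).toReal := by
    have h1 := mul_meas_ge_le_integral_of_nonneg (Filter.Eventually.of_forall hnn) hi (4 * a)
    have h2 : μ.real {z | ψ z ≤ m + 4 * a}ᶜ ≤ μ.real {x | 4 * a ≤ max (ψ x - m) 0} := by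
      apply measureReal_mono
      · intro z hz
        simp only [mem_compl_iff, mem_ofPred_eq, not_le] at hz ⊢
        exact le_max_of_le_left (by linarith)
      · exact measure_ne_top μ _
    rw [probReal_compl_eq_one_sub (hmeas _)] at h2
    change 3 / 4 ≤ μ.real _
    rw [← ha] at h1
    have h3 : μ.real {x | 4 * a ≤ max (ψ x - m) 0} ≤ 1 / 4 := by
      by_contra hc
      push Not at hc
      nlinarith
    linarith
  have key : ∀ l : ℝ, 0 < l → l < 1 →
      1 / 2 + l / 6 ≤ (μ {z | ψ z ≤ m + l * (4 * a)}).toReal := by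
    intro l hl hl1
    have h1 := hμ _ _ (hmeas (m + 4 * a)) (hmeas m) l hl hl1
    have h2 : l • {z | ψ z ≤ m + 4 * a} + (1 - l) • {z | ψ z ≤ m}
        ⊆ {z | ψ z ≤ m + l * (4 * a)} := by
      rintro _ ⟨_, ⟨x, hx, rfl⟩, _, ⟨y, hy, rfl⟩, rfl⟩
      simp only [mem_ofPred_eq] at hx hy ⊢
      have := hψ.2 (mem_univ x) (mem_univ y) hl.le (by linarith : 0 ≤ 1 - l) (by ring)
      simp only [smul_eq_mul] at this
      refine this.trans ?_
      nlinarith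
    have h3 := ENNReal.toReal_mono (measure_ne_top μ _) (h1.trans (measure_mono h2))
    rw [ENNReal.toReal_mul, ← ENNReal.toReal_rpow, ← ENNReal.toReal_rpow, hFm] at h3
    refine le_trans ?_ h3
    have h4 : (3 / 4 : ℝ) ^ l ≤ (μ {z | ψ z ≤ m + 4 * a}).toReal ^ l :=
      Real.rpow_le_rpow (by norm_num) hmk hl.le
    have h5 : (0 : ℝ) ≤ (1 / 2) ^ (1 - l) := by positivity
    refine le_trans ?_ (mul_le_mul_of_nonneg_right h4 h5)
    have h6 : (3 / 4 : ℝ) ^ l * (1 / 2) ^ (1 - l) = 1 / 2 * (3 / 2) ^ l := by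
      rw [show (3 / 4 : ℝ) = 3 / 2 * (1 / 2) by norm_num,
        Real.mul_rpow (by norm_num) (by norm_num), mul_assoc,
        ← Real.rpow_add (by norm_num)]
      simp [mul_comm]
    rw [h6, Real.rpow_def_of_pos (by norm_num)]
    have h7 := Real.add_one_le_exp (Real.log (3 / 2) * l)
    have h8 := Real.one_sub_inv_le_log_of_pos (by norm_num : (0 : ℝ) < 3 / 2)
    norm_num at h8
    nlinarith
  have hslope : 1 / (24 * a) ≤ fm := by
    have ht := hderiv.tendsto_slope_zero_right
    refine ge_of_tendsto ht ?_
    filter_upwards [Ioo_mem_nhdsGT (show (0 : ℝ) < 4 * a by positivity)] with h hh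
    have hk := key (h / (4 * a)) (div_pos hh.1 (by positivity))
      ((div_lt_one (by positivity)).2 hh.2)
    rw [div_mul_cancel₀ _ (by positivity)] at hk
    rw [hFm, smul_eq_mul, inv_mul_eq_div, le_div_iff₀ hh.1]
    have : 1 / (24 * a) * h = h / (4 * a) / 6 := by field_simp; ring
    linarith
  refine le_trans ?_ hslope
  exact one_div_le_one_div_of_le (by positivity) (by linarith)
end

section
/- Let μ be a log-concave probability measure on ℝⁿ, let ψ : ℝⁿ → ℝ be a convex function with ψ ∈ L¹(μ), and let m be a median of ψ with respect to μ. Then μ({x : ψ(x) < m − t·∫|ψ − m| dμ}) ≤ (1/2)·exp(−t/16) for all t > 0. -/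
open MeasureTheory ProbabilityTheory Real Set
open scoped ENNReal Pointwise

/-- Let `μ` be log-concave on `ℝⁿ`, `ψ` convex and `μ`-integrable, and
`m` a median of `ψ` with respect to `μ`. Then
`μ(ψ < m − t ∫|ψ−m| dμ) ≤ (1/2) e^{−t/16}` for all `t > 0`. -/
theorem small_deviation_below_median
    (n : ℕ) (μ : Measure (EuclideanSpace ℝ (Fin n))) [IsProbabilityMeasure μ]
    (hμ : IsLogConcave μ)
    (ψ : EuclideanSpace ℝ (Fin n) → ℝ) (hψ : ConvexOn ℝ Set.univ ψ)
    (hint : Integrable ψ μ)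
    (m : ℝ)
    (hmed : (1 : ENNReal) / 2 ≤ μ {z | ψ z ≤ m})
    (hmed' : (1 : ENNReal) / 2 ≤ μ {z | m ≤ ψ z}) :
    ∀ t : ℝ, 0 < t →
      μ {x | ψ x < m - t * ∫ x, |ψ x - m| ∂μ} ≤
        ENNReal.ofReal ((1 / 2) * Real.exp (-t / 16)) := by
  have hcont : Continuous ψ := by
    have h := hψ.continuousOn_interior
    rwa [interior_univ, continuousOn_univ] at h
  have hms : ∀ s : ℝ, MeasurableSet {x | ψ x < s} := fun s =>
    (isOpen_lt hcont continuous_const).measurableSet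
  intro t ht
  have hI : Integrable (fun x => |ψ x - m|) μ := (hint.sub (integrable_const m)).abs
  set D := ∫ x, |ψ x - m| ∂μ with hD
  have hD0 : 0 ≤ D := integral_nonneg fun x => abs_nonneg _
  -- the sublevel set below the median has mass at most one half
  have hC : μ.real {x | ψ x < m} ≤ 1 / 2 := by
    have h1 : μ.real {x | ψ x < m}ᶜ = 1 - μ.real {x | ψ x < m} := probReal_compl_eq_one_sub (hms m)
    have h2 : {x | ψ x < m}ᶜ = {z | m ≤ ψ z} := by ext x; simp
    have h3 : (1 : ℝ) / 2 ≤ μ.real {z | m ≤ ψ z} := by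
      have := ENNReal.toReal_mono (measure_ne_top μ _) hmed'
      simpa [Measure.real] using this
    rw [h2] at h1
    linarith
  rcases hD0.eq_or_lt with h0 | hDpos
  · have hae : ∀ᵐ x ∂μ, |ψ x - m| = 0 :=
      (integral_eq_zero_iff_of_nonneg (fun x => abs_nonneg (ψ x - m)) hI).1 h0.symm
    have hz : μ {x | ψ x < m - t * D} = 0 := by
      rw [← h0]
      refine measure_mono_null ?_ (ae_iff.1 hae)
      intro x hx
      simp only [mem_setOf_eq, mul_zero, sub_zero] at hx ⊢
      rw [abs_eq_zero, sub_eq_zero]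
      exact hx.ne
    rw [hz]; exact zero_le
  have hB : 3 / 4 ≤ μ.real {x | ψ x < m + 4 * D} := by
    have h1 := mul_meas_ge_le_integral_of_nonneg (μ := μ) (f := fun x => |ψ x - m|)
      (ae_of_all _ fun x => abs_nonneg _) hI (4 * D)
    have h2 : μ.real {x | ψ x < m + 4 * D}ᶜ = 1 - μ.real {x | ψ x < m + 4 * D} :=
      probReal_compl_eq_one_sub (hms _)
    have h3 : μ.real {x | ψ x < m + 4 * D}ᶜ ≤ μ.real {x | 4 * D ≤ |ψ x - m|} := by
      refine measureReal_mono ?_ (measure_ne_top _ _)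
      intro x hx
      simp only [mem_compl_iff, mem_setOf_eq, not_lt] at hx ⊢
      exact le_trans (by linarith) (le_abs_self _)
    have h4 : μ.real {x | 4 * D ≤ |ψ x - m|} ≤ 1 / 4 := by
      by_contra! hcon
      have : 4 * D * (1 / 4) < 4 * D * μ.real {x | 4 * D ≤ |ψ x - m|} :=
        mul_lt_mul_of_pos_left hcon (by positivity)
      linarith
    linarith
  set l : ℝ := 4 / (t + 4) with hl
  have hl0 : 0 < l := by positivity
  have hl1 : l < 1 := by rw [hl, div_lt_one (by positivity)]; linarith
  have hlt : l * (t + 4) = 4 := by rw [hl]; field_simp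
  have hsub : l • {x | ψ x < m - t * D} + (1 - l) • {x | ψ x < m + 4 * D} ⊆ {x | ψ x < m} := by
    rintro _ ⟨_, ⟨x, hx, rfl⟩, _, ⟨y, hy, rfl⟩, rfl⟩
    simp only [mem_setOf_eq] at hx hy ⊢
    have hc := hψ.2 (mem_univ x) (mem_univ y) hl0.le (by linarith : 0 ≤ 1 - l) (by ring)
    simp only [smul_eq_mul] at hc
    have e1 := mul_lt_mul_of_pos_left hx hl0
    have e2 := mul_lt_mul_of_pos_left hy (by linarith : 0 < 1 - l)
    have e3 : l * (m - t * D) + (1 - l) * (m + 4 * D) = m := by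
      linear_combination (-D) * hlt
    linarith
  have hlc := (hμ _ _ (hms (m - t * D)) (hms (m + 4 * D)) l hl0 hl1).trans (measure_mono hsub)
  have hreal : μ.real {x | ψ x < m - t * D} ^ l * μ.real {x | ψ x < m + 4 * D} ^ (1 - l) ≤ 1 / 2 := by
    have := ENNReal.toReal_mono (measure_ne_top μ _) hlc
    rw [ENNReal.toReal_mul, ← ENNReal.toReal_rpow, ← ENNReal.toReal_rpow] at this
    exact this.trans hC
  rw [← ofReal_measureReal (measure_ne_top μ _)]
  apply ENNReal.ofReal_le_ofReal
  have ha0 : 0 ≤ μ.real {x | ψ x < m - t * D} := measureReal_nonneg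
  generalize μ.real {x | ψ x < m - t * D} = a at *
  generalize μ.real {x | ψ x < m + 4 * D} = b at *
  rcases ha0.eq_or_lt with h0 | ha
  · rw [← h0]; positivity
  have hb : 0 < b := by linarith
  have hlog := Real.log_le_log (by positivity) hreal
  rw [Real.log_mul (by positivity) (by positivity), Real.log_rpow ha, Real.log_rpow hb] at hlog
  have hlb : Real.log (3 / 4) ≤ Real.log b := Real.log_le_log (by norm_num) hB
  have h23 : Real.log (1 / 2) - Real.log (3 / 4) ≤ -1 / 3 := by
    rw [← Real.log_div (by norm_num) (by norm_num)]
    have := Real.log_le_sub_one_of_pos (by norm_num : (0 : ℝ) < 1 / 2 / (3 / 4))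
    norm_num at this ⊢
    linarith
  have h5 : 4 * Real.log a + t * Real.log b ≤ (t + 4) * Real.log (1 / 2) := by
    have := mul_le_mul_of_nonneg_left hlog (by positivity : 0 ≤ t + 4)
    have e : (t + 4) * (l * Real.log a + (1 - l) * Real.log b)
        = 4 * Real.log a + t * Real.log b := by
      linear_combination (Real.log a - Real.log b) * hlt
    linarith
  have h6 := mul_le_mul_of_nonneg_left hlb ht.le
  have h7 := mul_le_mul_of_nonneg_left h23 ht.le
  have h8 : Real.log a ≤ Real.log (1 / 2) + -t / 16 := by linarith
  calc a = Real.exp (Real.log a) := (Real.exp_log ha).symm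
    _ ≤ Real.exp (Real.log (1 / 2) + -t / 16) := Real.exp_le_exp.2 h8
    _ = 1 / 2 * Real.exp (-t / 16) := by rw [Real.exp_add, Real.exp_log (by norm_num)]
end

section
/- Let K be a symmetric convex body in ℝⁿ and let μ be a log-concave probability measure on ℝⁿ such that the random variable ‖Z‖_K (Z ~ μ) has a density f_K; let m be its median. Then there is an absolute constant c > 0 such that for every ε ∈ (0,1): μ({x : ‖x‖_K ≤ (1−ε)m}) ≤ (1/2)·exp(−2ε·ϑ_μ(K)) ≤ (1/2)·exp(−c·ε/√(β_μ(K))), where ϑ_μ(K) = m·f_K(m) and β_μ(K) = Var‖Z‖_K/(E‖Z‖_K)². -/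
open MeasureTheory ProbabilityTheory Real Set
open scoped ENNReal Pointwise

/-- Tangent-line bound for a log-concave distribution function at its median. -/
lemma tangent_bound (F : ℝ → ℝ) (f m : ℝ) (hF0 : ∀ t, 0 ≤ F t) (hm : F m = 1 / 2)
    (hd : HasDerivAt F f m)
    (hlc : ∀ s t l : ℝ, 0 < l → l < 1 → F s ^ l * F t ^ (1 - l) ≤ F (l * s + (1 - l) * t))
    (t : ℝ) : F t ≤ 1 / 2 * Real.exp (2 * f * (t - m)) := by
  rcases (hF0 t).eq_or_lt with h0 | h0
  · rw [← h0]; positivity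
  set L := Real.log (2 * F t) with hL
  have hexp : Real.exp L = 2 * F t := Real.exp_log (by linarith)
  have hd1 : HasDerivAt (fun l : ℝ => F (m + l * (t - m)) - 1 / 2 * Real.exp (l * L))
      (f * (t - m) - 1 / 2 * L) 0 := by
    have h1 : HasDerivAt (fun l : ℝ => m + l * (t - m)) (t - m) 0 := by
      simpa using ((hasDerivAt_id (0 : ℝ)).mul_const (t - m)).const_add m
    have h2 : HasDerivAt (fun l : ℝ => Real.exp (l * L)) L 0 := by
      simpa using ((hasDerivAt_id (0 : ℝ)).mul_const L).exp
    have h3 : HasDerivAt F f (m + 0 * (t - m)) := by simpa using hd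
    exact (h3.comp (0 : ℝ) h1).sub (h2.const_mul (1 / 2))
  have hlim := hd1.tendsto_slope_zero_right
  have hge : 0 ≤ f * (t - m) - 1 / 2 * L := by
    refine ge_of_tendsto hlim ?_
    filter_upwards [Ioo_mem_nhdsGT (show (0 : ℝ) < 1 by norm_num)] with l hl
    have h := hlc t m l hl.1 hl.2
    have h4 : F t ^ l * F m ^ (1 - l) = 1 / 2 * Real.exp (l * L) := by
      have : F t = 1 / 2 * Real.exp L := by rw [hexp]; ring
      rw [this, hm, Real.mul_rpow (by norm_num) (Real.exp_pos _).le, ← Real.exp_mul,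
        mul_right_comm, ← Real.rpow_add (by norm_num)]
      rw [mul_comm L l]; simp
    rw [h4] at h
    have h5 : l * t + (1 - l) * m = m + l * (t - m) := by ring
    rw [h5] at h
    have : 0 < l⁻¹ := inv_pos.2 hl.1
    simp only [smul_eq_mul, zero_add, zero_mul, add_zero, Real.exp_zero, hm]
    apply mul_nonneg this.le
    linarith
  have : L ≤ 2 * f * (t - m) := by linarith
  have := Real.exp_le_exp.2 this
  rw [hexp] at this
  linarith

/-- The mass between `m` and `5m` is at least a quarter. -/
lemma shell_bound {n : ℕ} (K : Set (EuclideanSpace ℝ (Fin n)))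
    (hc : Convex ℝ K) (hsym : ∀ x ∈ K, -x ∈ K) (hK0 : K ∈ nhds 0)
    (μ : Measure (EuclideanSpace ℝ (Fin n))) [IsProbabilityMeasure μ]
    (hlc : IsLogConcave μ) (m : ℝ) (hm : 0 < m)
    (hF : μ.real {x | gauge K x ≤ m} = 1 / 2) :
    3 / 4 ≤ μ.real {x | gauge K x ≤ 5 * m} := by
  have hcont : Continuous (gauge K) := continuous_gauge hc hK0
  have habs : Absorbent ℝ K := absorbent_nhds_zero hK0
  have hms : ∀ t, MeasurableSet {x | gauge K x ≤ t} := fun t =>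
    measurableSet_le hcont.measurable measurable_const
  have hms2 : ∀ a b, MeasurableSet {x | a < gauge K x ∧ gauge K x ≤ b} := fun a b =>
    (measurableSet_lt measurable_const hcont.measurable).inter (hms b)
  have hsplit : ∀ a b, a ≤ b → μ.real {x | gauge K x ≤ b} =
      μ.real {x | gauge K x ≤ a} + μ.real {x | a < gauge K x ∧ gauge K x ≤ b} := by
    intro a b hab
    rw [← measureReal_union _ (hms2 a b)]
    · congr 1
      ext x
      simp only [mem_ofPred_eq, mem_union]
      constructor
      · intro h
        rcases le_or_gt (gauge K x) a with h' | h'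
        · exact Or.inl h'
        · exact Or.inr ⟨h', h⟩
      · rintro (h | h)
        · exact h.trans hab
        · exact h.2
    · rw [Set.disjoint_left]
      intro x hx hx'
      exact absurd hx'.1 (not_lt.2 hx)
  by_contra hlt
  push Not at hlt
  set q := μ.real {x | m < gauge K x ∧ gauge K x ≤ 5 * m} with hq
  have hq4 : q < 1 / 4 := by
    have := hsplit m (5 * m) (by linarith)
    rw [hF] at this
    linarith
  have hpj : ∀ j : ℕ, μ.real {x | 4 * 2 ^ j * m < gauge K x ∧ gauge K x ≤ 4 * 2 ^ (j + 1) * m}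
      ≤ 1 / 2 * (1 / 4) ^ (j + 1) := by
    intro j
    set B := {x | 4 * 2 ^ j * m < gauge K x ∧ gauge K x ≤ 4 * 2 ^ (j + 1) * m} with hB
    set A := {x | gauge K x ≤ m} with hA
    set l : ℝ := 1 / 2 ^ (j + 1) with hl
    have h2 : (1 : ℝ) < 2 ^ (j + 1) := one_lt_pow₀ (by norm_num) (by omega)
    have hl0 : 0 < l := by positivity
    have hl1 : l < 1 := by rw [hl, div_lt_one (by positivity)]; exact h2
    have hl2 : l * 2 ^ (j + 1) = 1 := by rw [hl]; field_simp
    have hsub : l • B + (1 - l) • A ⊆ {x | m < gauge K x ∧ gauge K x ≤ 5 * m} := by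
      rintro _ ⟨_, ⟨y, hy, rfl⟩, _, ⟨x, hx, rfl⟩, rfl⟩
      have hgy : gauge K (l • y) = l * gauge K y := by
        rw [gauge_smul_of_nonneg hl0.le, smul_eq_mul]
      have hgx : gauge K ((1 - l) • x) = (1 - l) * gauge K x := by
        rw [gauge_smul_of_nonneg (by linarith), smul_eq_mul]
      have hup := gauge_add_le hc habs (l • y) ((1 - l) • x)
      have hlo := gauge_add_le hc habs (l • y + (1 - l) • x) (-((1 - l) • x))
      rw [add_neg_cancel_right, gauge_neg hsym] at hlo
      rw [hgy, hgx] at hup hlo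
      have hx' : gauge K x ≤ m := hx
      have e1 : (1 - l) * gauge K x ≤ (1 - l) * m :=
        mul_le_mul_of_nonneg_left hx' (by linarith)
      have e2 : l * (4 * 2 ^ j * m) < l * gauge K y := mul_lt_mul_of_pos_left hy.1 hl0
      have e3 : l * gauge K y ≤ l * (4 * 2 ^ (j + 1) * m) :=
        mul_le_mul_of_nonneg_left hy.2 hl0.le
      have e4 : l * (4 * 2 ^ j * m) = 2 * m := by
        have : l * (4 * 2 ^ j * m) = 2 * (l * 2 ^ (j + 1)) * m := by ring
        rw [this, hl2]; ring
      have e5 : l * (4 * 2 ^ (j + 1) * m) = 4 * m := by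
        have : l * (4 * 2 ^ (j + 1) * m) = 4 * (l * 2 ^ (j + 1)) * m := by ring
        rw [this, hl2]; ring
      have e6 : 0 < l * m := mul_pos hl0 hm
      constructor <;> simp only [] <;> nlinarith
    have h := (hlc B A (hms2 _ _) (hms _) l hl0 hl1).trans (measure_mono hsub)
    have hr : μ.real B ^ l * μ.real A ^ (1 - l) ≤ q := by
      have := ENNReal.toReal_mono (measure_ne_top μ _) h
      rw [ENNReal.toReal_mul, ← ENNReal.toReal_rpow, ← ENNReal.toReal_rpow] at this
      exact this
    rw [hF] at hr
    set p := μ.real B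
    have hp0 : 0 ≤ p := measureReal_nonneg
    have h3 : (2 * p) ^ l ≤ 1 / 2 := by
      have h4 : p ^ l * (1 / 2 : ℝ) ^ (1 - l) = 1 / 2 * (2 * p) ^ l := by
        rw [Real.rpow_sub (by norm_num), Real.rpow_one, Real.mul_rpow (by norm_num) hp0,
          Real.div_rpow (by norm_num) (by norm_num), Real.one_rpow]
        field_simp
      rw [h4] at hr
      linarith
    have h5 : 2 * p ≤ (1 / 2) ^ (2 ^ (j + 1)) := by
      have h6 : ((2 * p) ^ l) ^ (2 ^ (j + 1)) = 2 * p := by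
        rw [← Real.rpow_natCast, ← Real.rpow_mul (by positivity)]
        push_cast
        rw [hl2, Real.rpow_one]
      rw [← h6]
      exact pow_le_pow_left₀ (by positivity) h3 _
    have h7 : (1 / 2 : ℝ) ^ (2 ^ (j + 1)) ≤ (1 / 2) ^ (2 * (j + 1)) := by
      apply pow_le_pow_of_le_one (by norm_num) (by norm_num)
      have : j + 1 ≤ 2 ^ j := Nat.lt_two_pow_self
      rw [pow_succ]; omega
    rw [pow_mul] at h7
    norm_num at h7 h5 ⊢
    linarith
  have hind : ∀ j : ℕ, μ.real {x | gauge K x ≤ 4 * 2 ^ j * m} ≤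
      11 / 12 - 1 / 6 * (1 / 4) ^ j := by
    intro j
    induction j with
    | zero =>
      have : μ.real {x | gauge K x ≤ 4 * 2 ^ 0 * m} ≤ μ.real {x | gauge K x ≤ 5 * m} := by
        refine measureReal_mono ?_ (measure_ne_top μ _)
        intro x hx
        have hx : gauge K x ≤ 4 * 2 ^ 0 * m := hx
        show gauge K x ≤ 5 * m
        linarith
      norm_num at this ⊢
      linarith
    | succ j ih =>
      have h1 : (4 : ℝ) * 2 ^ j * m ≤ 4 * 2 ^ (j + 1) * m := by
        have : 0 < (2 : ℝ) ^ j * m := by positivity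
        rw [pow_succ]; nlinarith
      rw [hsplit _ _ h1]
      have h2 := hpj j
      have h3 : (1 / 4 : ℝ) ^ (j + 1) = (1 / 4) ^ j * (1 / 4) := pow_succ _ _
      rw [h3] at h2 ⊢
      linarith
  have hlim : Filter.Tendsto (fun j : ℕ => μ {x | gauge K x ≤ 4 * 2 ^ j * m}) Filter.atTop
      (nhds (μ univ)) := by
    have hmono : Monotone (fun j : ℕ => {x | gauge K x ≤ 4 * 2 ^ j * m}) := by
      intro i j hij x hx
      have hx : gauge K x ≤ 4 * 2 ^ i * m := hx
      show gauge K x ≤ 4 * 2 ^ j * m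
      refine hx.trans ?_
      have : (2 : ℝ) ^ i ≤ 2 ^ j := pow_le_pow_right₀ (by norm_num) hij
      gcongr
    have := tendsto_measure_iUnion_atTop (μ := μ) hmono
    suffices hU : (⋃ j : ℕ, {x | gauge K x ≤ 4 * 2 ^ j * m}) = univ by
      rw [hU] at this
      exact this
    rw [eq_univ_iff_forall]
    intro x
    rw [mem_iUnion]
    obtain ⟨j, hj⟩ := pow_unbounded_of_one_lt (gauge K x / m) (one_lt_two : (1 : ℝ) < 2)
    refine ⟨j, ?_⟩
    rw [div_lt_iff₀ hm] at hj
    have : 0 < (2 : ℝ) ^ j * m := by positivity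
    show gauge K x ≤ 4 * 2 ^ j * m
    linarith
  have hlim2 := (ENNReal.tendsto_toReal (measure_ne_top μ univ)).comp hlim
  have : (μ univ).toReal ≤ 11 / 12 := by
    refine le_of_tendsto hlim2 (Filter.Eventually.of_forall fun j => ?_)
    have h1 := hind j
    have : (0 : ℝ) < (1 / 4) ^ j := by positivity
    show μ.real _ ≤ _
    linarith
  simp at this
  norm_num at this

/-- Let `K` be a symmetric convex body in `ℝⁿ` and `μ` a log-concave
probability measure such that `‖Z‖_K = gauge K Z` has density `f_K` and median `m`
(the value `f_K(m)` being the derivative of the cumulative distribution function at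
`m`). Then for an absolute constant `c > 0` and every `ε ∈ (0,1)`:
`μ(‖x‖_K ≤ (1−ε)m) ≤ (1/2) e^{−2ε ϑ_μ(K)} ≤ (1/2) e^{−c ε/√β_μ(K)}`, where
`ϑ_μ(K) = m f_K(m)` and `β_μ(K) = Var‖Z‖_K/(E‖Z‖_K)²`. -/
theorem small_deviation_theta_beta :
    ∃ c : ℝ, 0 < c ∧
      ∀ (n : ℕ) (K : Set (EuclideanSpace ℝ (Fin n))),
        IsCompact K → Convex ℝ K → K = -K → (interior K).Nonempty →
      ∀ (μ : Measure (EuclideanSpace ℝ (Fin n))), IsProbabilityMeasure μ →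
        IsLogConcave μ →
      ∀ (fK : ℝ → ℝ) (m : ℝ),
        μ.map (gauge K) = volume.withDensity (fun t => ENNReal.ofReal (fK t)) →
        HasDerivAt (fun t => (μ {x | gauge K x ≤ t}).toReal) (fK m) m →
        (1 : ENNReal) / 2 ≤ μ {x | gauge K x ≤ m} →
        (1 : ENNReal) / 2 ≤ μ {x | m ≤ gauge K x} →
      ∀ ε : ℝ, 0 < ε → ε < 1 →
        μ {x | gauge K x ≤ (1 - ε) * m} ≤
          ENNReal.ofReal ((1 / 2) * Real.exp (-(2 * ε * (m * fK m)))) ∧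
        (1 / 2 : ℝ) * Real.exp (-(2 * ε * (m * fK m))) ≤
          (1 / 2 : ℝ) * Real.exp
            (-(c * ε / Real.sqrt
              (variance (gauge K) μ / (∫ x, gauge K x ∂μ) ^ 2))) := by
  have hlog : 0 < Real.log (3 / 2) := Real.log_pos (by norm_num)
  refine ⟨Real.log (3 / 2) / 15, by positivity, ?_⟩
  intro n K _ hc hKs hKi μ hμ hlc fK m hmap hder hm1 hm2 ε hε0 hε1
  have hsym : ∀ x ∈ K, -x ∈ K := by
    intro x hx
    rw [hKs] at hx
    exact hx
  have hK0 : K ∈ nhds 0 := by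
    obtain ⟨x, hx⟩ := hKi
    have hnx : -x ∈ interior K := by
      have h1 : -interior K ⊆ interior K := by
        refine interior_maximal ?_ isOpen_interior.neg
        intro y hy
        have := hsym _ (interior_subset hy)
        simpa using this
      apply h1
      simpa using hx
    have h0 : (0 : EuclideanSpace ℝ (Fin n)) ∈ interior K := by
      have := hc.interior hx hnx (show (0 : ℝ) ≤ 1 / 2 by norm_num)
        (show (0 : ℝ) ≤ 1 / 2 by norm_num) (by norm_num)
      simpa using this
    exact mem_interior_iff_mem_nhds.1 h0
  have hcont : Continuous (gauge K) := continuous_gauge hc hK0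
  have habs : Absorbent ℝ K := absorbent_nhds_zero hK0
  have hms : ∀ t, MeasurableSet {x | gauge K x ≤ t} := fun t =>
    measurableSet_le hcont.measurable measurable_const
  have hatom : ∀ t, μ {x | gauge K x = t} = 0 := by
    intro t
    have h1 : μ.map (gauge K) {t} = 0 := by
      rw [hmap]
      exact withDensity_absolutelyContinuous _ _ (by simp)
    rwa [Measure.map_apply hcont.measurable (measurableSet_singleton t)] at h1
  set F : ℝ → ℝ := fun t => μ.real {x | gauge K x ≤ t} with hFdef
  have hhalf : F m = 1 / 2 := by
    have h1 : (1 / 2 : ℝ) ≤ F m := by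
      have := ENNReal.toReal_mono (measure_ne_top μ _) hm1
      simpa [hFdef, Measure.real] using this
    have h2 : (1 / 2 : ℝ) ≤ μ.real {x | m ≤ gauge K x} := by
      have := ENNReal.toReal_mono (measure_ne_top μ _) hm2
      simpa [Measure.real] using this
    have h3 : μ.real {x | m ≤ gauge K x} ≤ μ.real {x | gauge K x = m}
        + μ.real {x | gauge K x ≤ m}ᶜ := by
      refine (measureReal_mono ?_).trans (measureReal_union_le _ _)
      intro x hx
      have hx : m ≤ gauge K x := hx
      rcases hx.eq_or_lt with h | h
      · exact Or.inl h.symm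
      · exact Or.inr (not_le.2 h)
    rw [measureReal_compl (hms m)] at h3
    have h4 : μ.real {x | gauge K x = m} = 0 := by simp [Measure.real, hatom m]
    have h5 : μ.real univ = 1 := by simp
    rw [h4, h5] at h3
    have h6 : F m = μ.real {x | gauge K x ≤ m} := rfl
    linarith
  have hmpos : 0 < m := by
    by_contra hneg
    push Not at hneg
    have h1 : F m ≤ μ.real {x | gauge K x = 0} := by
      refine measureReal_mono ?_ (measure_ne_top μ _)
      intro x hx
      have hx : gauge K x ≤ m := hx
      exact le_antisymm (hx.trans hneg) (gauge_nonneg x)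
    have h4 : μ.real {x | gauge K x = 0} = 0 := by simp [Measure.real, hatom 0]
    rw [h4, hhalf] at h1
    norm_num at h1
  have hFlc : ∀ s t l : ℝ, 0 < l → l < 1 →
      F s ^ l * F t ^ (1 - l) ≤ F (l * s + (1 - l) * t) := by
    intro s t l hl0 hl1
    have hsub : l • {x | gauge K x ≤ s} + (1 - l) • {x | gauge K x ≤ t} ⊆
        {x | gauge K x ≤ l * s + (1 - l) * t} := by
      rintro _ ⟨_, ⟨y, hy, rfl⟩, _, ⟨x, hx, rfl⟩, rfl⟩
      have hup := gauge_add_le hc habs (l • y) ((1 - l) • x)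
      rw [gauge_smul_of_nonneg hl0.le, gauge_smul_of_nonneg (by linarith),
        smul_eq_mul, smul_eq_mul] at hup
      have e1 : (1 - l) * gauge K x ≤ (1 - l) * t :=
        mul_le_mul_of_nonneg_left hx (by linarith)
      have e2 : l * gauge K y ≤ l * s := mul_le_mul_of_nonneg_left hy hl0.le
      show gauge K (l • y + (1 - l) • x) ≤ _
      linarith
    have h := (hlc _ _ (hms s) (hms t) l hl0 hl1).trans (measure_mono hsub)
    have := ENNReal.toReal_mono (measure_ne_top μ _) h
    rw [ENNReal.toReal_mul, ← ENNReal.toReal_rpow, ← ENNReal.toReal_rpow] at this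
    exact this
  have htan := tangent_bound F (fK m) m (fun t => measureReal_nonneg) hhalf hder hFlc
  have h5m : 3 / 4 ≤ F (5 * m) := shell_bound K hc hsym hK0 μ hlc m hmpos hhalf
  have hkey : ∀ t, 3 / 4 ≤ F t → Real.log (3 / 2) ≤ 2 * fK m * (t - m) := by
    intro t ht
    rw [Real.log_le_iff_le_exp (by norm_num)]
    have := htan t
    linarith
  have hfm := hkey _ h5m
  have hfm' : Real.log (3 / 2) / 8 ≤ m * fK m := by nlinarith
  constructor
  · rw [← ENNReal.ofReal_toReal (measure_ne_top μ _)]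
    apply ENNReal.ofReal_le_ofReal
    have := htan ((1 - ε) * m)
    have e : 2 * fK m * ((1 - ε) * m - m) = -(2 * ε * (m * fK m)) := by ring
    rw [e] at this
    exact this
  · apply mul_le_mul_of_nonneg_left _ (by norm_num)
    rw [Real.exp_le_exp, neg_le_neg_iff]
    set E := ∫ x, gauge K x ∂μ with hE
    have hE0 : 0 ≤ E := integral_nonneg fun x => gauge_nonneg x
    set V := variance (gauge K) μ with hV
    have hV0 : 0 ≤ V := variance_nonneg _ _
    rw [Real.sqrt_div' _ (sq_nonneg E), Real.sqrt_sq hE0]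
    set σ := Real.sqrt V with hσ
    have hσ0 : 0 ≤ σ := Real.sqrt_nonneg _
    rcases hσ0.eq_or_lt with h0 | hσpos
    · rw [← h0]
      simp only [zero_div, div_zero]
      have : 0 < m * fK m := by linarith
      positivity
    have hVσ : V = σ ^ 2 := (Real.sq_sqrt hV0).symm
    have hL2 : MemLp (gauge K) 2 μ := by
      by_contra hn
      have : V = 0 := variance_of_not_memLp hcont.aestronglyMeasurable hn
      rw [this] at hVσ
      have : 0 < σ ^ 2 := by positivity
      linarith
    have hcheb : ∀ c : ℝ, 0 < c → μ.real {x | c * σ ≤ |gauge K x - E|} ≤ 1 / c ^ 2 := by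
      intro c hc
      have h1 := meas_ge_le_variance_div_sq hL2 (mul_pos hc hσpos)
      have h2 := ENNReal.toReal_mono ENNReal.ofReal_ne_top h1
      rw [ENNReal.toReal_ofReal (by positivity), ← hV, hVσ] at h2
      have e : σ ^ 2 / (c * σ) ^ 2 = 1 / c ^ 2 := by field_simp
      rw [e] at h2
      exact h2
    have hEm : E ≤ m + 2 * σ := by
      by_contra hlt
      push Not at hlt
      have h1 : F m ≤ μ.real {x | 2 * σ ≤ |gauge K x - E|} := by
        refine measureReal_mono ?_ (measure_ne_top μ _)
        intro x hx
        have hx : gauge K x ≤ m := hx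
        show 2 * σ ≤ |gauge K x - E|
        rw [abs_sub_comm]
        refine le_trans ?_ (le_abs_self _)
        linarith
      have h2 := hcheb 2 (by norm_num)
      rw [hhalf] at h1
      norm_num at h1 h2
      linarith
    have hF5 : 3 / 4 ≤ F (m + 5 * σ) := by
      have h1 : μ.real {x | gauge K x ≤ m + 5 * σ}ᶜ ≤ μ.real {x | 3 * σ ≤ |gauge K x - E|} := by
        refine measureReal_mono ?_ (measure_ne_top μ _)
        intro x hx
        have hx : m + 5 * σ < gauge K x := not_le.1 hx
        show 3 * σ ≤ |gauge K x - E|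
        refine le_trans ?_ (le_abs_self _)
        linarith
      rw [measureReal_compl (hms _)] at h1
      have h2 := hcheb 3 (by norm_num)
      have h5 : μ.real univ = 1 := by simp
      have h6 : F (m + 5 * σ) = μ.real {x | gauge K x ≤ m + 5 * σ} := rfl
      rw [h5] at h1
      norm_num at h2
      linarith
    have hfs := hkey _ hF5
    have hfpos : 0 < fK m := by
      by_contra hn
      push Not at hn
      nlinarith
    have hmain : Real.log (3 / 2) * E ≤ 30 * (m * fK m) * σ := by
      have e1 : Real.log (3 / 2) * E ≤ Real.log (3 / 2) * (m + 2 * σ) :=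
        mul_le_mul_of_nonneg_left hEm hlog.le
      have e2 : Real.log (3 / 2) * m ≤ 10 * fK m * σ * m :=
        mul_le_mul_of_nonneg_right (by linarith) hmpos.le
      have e3 : Real.log (3 / 2) * σ ≤ 8 * (m * fK m) * σ :=
        mul_le_mul_of_nonneg_right (by linarith) hσpos.le
      have e4 : 0 < m * fK m * σ := by positivity
      nlinarith
    rw [div_div_eq_mul_div, div_le_iff₀ hσpos]
    have := mul_le_mul_of_nonneg_left hmain hε0.le
    nlinarith
end

section
/- Let K be a symmetric convex body in ℝⁿ and μ a log-concave probability measure on ℝⁿ such that ‖Z‖_K (Z ~ μ) has density f_K with median m. If the pair (μ, K) has the B-property and μ(K) ≤ 1/2, then μ(εK) ≤ ε^{2f_K(m)}·μ(K) for all ε ∈ (0,1); in particular, μ({x : ‖x‖_K ≤ ε·m}) ≤ (1/2)·ε^{2ϑ_μ(K)} for all ε ∈ (0,1), where ϑ_μ(K) = m·f_K(m). -/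
open MeasureTheory ProbabilityTheory Real Set
open scoped ENNReal Pointwise

lemma concave_aux (F : ℝ → ℝ) (hmono : Monotone F)
    (hB : ∀ t s l : ℝ, 0 < l → l < 1 →
      F (exp t) ^ (1 - l) * F (exp s) ^ l ≤ F (exp ((1 - l) * t + l * s)))
    (u : ℝ) (hu : 0 < F (exp u)) :
    ConcaveOn ℝ (Ici u) (fun t => Real.log (F (exp t))) := by
  have hpos : ∀ t, u ≤ t → 0 < F (exp t) := fun t ht =>
    hu.trans_le (hmono (exp_le_exp.2 ht))
  refine ⟨convex_Ici u, ?_⟩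
  intro x hx y hy a b ha hb hab
  have hx' := hpos x hx
  have hy' := hpos y hy
  rcases ha.eq_or_lt with rfl | ha
  · obtain rfl : b = 1 := by linarith
    simp
  rcases hb.eq_or_lt with rfl | hb
  · obtain rfl : a = 1 := by linarith
    simp
  have h := hB x y b hb (by linarith)
  obtain rfl : a = 1 - b := by linarith
  have h2 := Real.log_le_log (mul_pos (rpow_pos_of_pos hx' _) (rpow_pos_of_pos hy' _)) h
  rw [Real.log_mul (rpow_pos_of_pos hx' _).ne' (rpow_pos_of_pos hy' _).ne',
    Real.log_rpow hx', Real.log_rpow hy'] at h2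
  simpa using h2

lemma core_aux (F : ℝ → ℝ) (f m : ℝ) (hmono : Monotone F) (hnn : ∀ t, 0 ≤ F t)
    (hlim : Filter.Tendsto F Filter.atTop (nhds 1))
    (hB : ∀ t s l : ℝ, 0 < l → l < 1 →
      F (exp t) ^ (1 - l) * F (exp s) ^ l ≤ F (exp ((1 - l) * t + l * s)))
    (hm : 0 < m) (hFm : F m = 1 / 2) (hd : HasDerivAt F f m) (hF1 : F 1 ≤ 1 / 2)
    (ε : ℝ) (h0 : 0 < ε) (h1 : ε < 1) :
    F ε ≤ ε ^ (2 * f) * F 1 ∧ F (ε * m) ≤ 1 / 2 * ε ^ (2 * (m * f)) := by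
  have hf : 0 ≤ f := by
    rw [← hd.deriv]; exact hmono.deriv_nonneg
  have hm1 : 1 ≤ m := by
    by_contra hlt
    push Not at hlt
    have hF1' : F 1 = 1 / 2 := le_antisymm hF1 (hFm ▸ hmono hlt.le)
    obtain ⟨T, hT, hT1⟩ := ((hlim.eventually (lt_mem_nhds (show (1/2:ℝ) < 1 by norm_num))).and
      (Filter.eventually_gt_atTop 1)).exists
    have hc := concave_aux F hmono hB (Real.log m) (by rw [exp_log hm, hFm]; norm_num)
    have hlm : Real.log m < 0 := Real.log_neg hm hlt
    have hlT : 0 < Real.log T := Real.log_pos hT1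
    have := hc.slope_anti_adjacent (x := Real.log m) (y := 0) (z := Real.log T)
      (by simp) (by simp only [mem_Ici]; linarith) hlm hlT
    simp only [exp_log hm, exp_log (show 0 < T by linarith), exp_zero, hF1', hFm, sub_self,
      zero_div] at this
    have h3 : Real.log (1/2) < Real.log (F T) := Real.log_lt_log (by norm_num) hT
    have h4 : 0 < (Real.log (F T) - Real.log (1/2)) / (Real.log T - 0) :=
      div_pos (by linarith) (by linarith)
    linarith
  have hlm : 0 ≤ Real.log m := Real.log_nonneg hm1
  have hder : HasDerivAt (fun t => Real.log (F (exp t))) (2 * (m * f)) (Real.log m) := by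
    have e1 : HasDerivAt F f (exp (Real.log m)) := by rwa [exp_log hm]
    have e2 := e1.comp (Real.log m) (Real.hasDerivAt_exp (Real.log m))
    have e3 := e2.log (by simp only [Function.comp, exp_log hm, hFm]; norm_num)
    convert e3 using 1
    · rfl
    · rw [Function.comp_apply, exp_log hm, hFm]; ring
  have key : ∀ c, 0 < c → c ≤ m → F (ε * c) ≤ ε ^ (2 * (m * f)) * F c := by
    intro c hc hcm
    have hεc : 0 < ε * c := mul_pos h0 hc
    rcases (hnn (ε * c)).eq_or_lt with hz | hz
    · rw [← hz]; exact mul_nonneg (rpow_nonneg h0.le _) (hnn _)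
    have hlt : ε * c < c := by nlinarith
    have hFc : 0 < F c := hz.trans_le (hmono hlt.le)
    have hcc := concave_aux F hmono hB (Real.log (ε * c)) (by rwa [exp_log hεc])
    have hl1 : Real.log (ε * c) < Real.log c := Real.log_lt_log hεc hlt
    have hl2 : Real.log c ≤ Real.log m := Real.log_le_log hc hcm
    have hs : 2 * (m * f) ≤ (Real.log (F c) - Real.log (F (ε * c))) /
        (Real.log c - Real.log (ε * c)) := by
      rcases hl2.eq_or_lt with he | hl
      · have := hcc.le_slope_of_hasDerivAt (x := Real.log (ε * c)) (y := Real.log m)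
          (by simp) (by simp only [mem_Ici]; linarith) (by linarith) hder
        rw [← he, slope_def_field] at this
        simpa only [exp_log hc, exp_log hεc] using this
      · have a1 := hcc.le_slope_of_hasDerivAt (x := Real.log c) (y := Real.log m)
          (by simp only [mem_Ici]; linarith) (by simp only [mem_Ici]; linarith) hl hder
        have a2 := hcc.slope_anti_adjacent (x := Real.log (ε * c)) (y := Real.log c)
          (z := Real.log m) (by simp) (by simp only [mem_Ici]; linarith) hl1 hl
        rw [slope_def_field] at a1
        have := a1.trans a2
        simpa only [exp_log hc, exp_log hεc] using this
    rw [le_div_iff₀ (by linarith), Real.log_mul h0.ne' hc.ne'] at hs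
    rw [← Real.log_le_log_iff hz (mul_pos (rpow_pos_of_pos h0 _) hFc),
      Real.log_mul (rpow_pos_of_pos h0 _).ne' hFc.ne', Real.log_rpow h0]
    linarith
  constructor
  · have := key 1 one_pos hm1
    rw [mul_one] at this
    refine this.trans (mul_le_mul_of_nonneg_right ?_ (hnn 1))
    exact rpow_le_rpow_of_exponent_ge h0 h1.le (by nlinarith)
  · have := key m hm le_rfl
    rw [hFm] at this
    linarith

/-- Let `K` be a symmetric convex body in `ℝⁿ` and `μ` a log-concave
probability measure such that `‖Z‖_K = gauge K Z` has density `f_K` with median `m`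
(the value `f_K(m)` being the derivative of the cumulative distribution function at `m`).
If the pair `(μ, K)` has the B-property (`t ↦ μ(e^t K)` is log-concave) and
`μ(K) ≤ 1/2`, then `μ(εK) ≤ ε^{2 f_K(m)} μ(K)` for all `ε ∈ (0,1)`; in particular
`μ(‖x‖_K ≤ ε m) ≤ (1/2) ε^{2 ϑ_μ(K)}` with `ϑ_μ(K) = m f_K(m)`. -/
theorem small_ball_B_property
    (n : ℕ) (K : Set (EuclideanSpace ℝ (Fin n)))
    (hKc : IsCompact K) (hKconv : Convex ℝ K) (hKsymm : K = -K)
    (hKint : (interior K).Nonempty)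
    (μ : Measure (EuclideanSpace ℝ (Fin n))) [IsProbabilityMeasure μ]
    (hμ : IsLogConcave μ)
    (fK : ℝ → ℝ) (m : ℝ)
    (hdens : μ.map (gauge K) = volume.withDensity (fun t => ENNReal.ofReal (fK t)))
    (hderiv : HasDerivAt (fun t => (μ {x | gauge K x ≤ t}).toReal) (fK m) m)
    (hmed : (1 : ENNReal) / 2 ≤ μ {x | gauge K x ≤ m})
    (hmed' : (1 : ENNReal) / 2 ≤ μ {x | m ≤ gauge K x})
    (hB : ∀ t s l : ℝ, 0 < l → l < 1 →
      μ (Real.exp t • K) ^ (1 - l) * μ (Real.exp s • K) ^ l ≤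
        μ (Real.exp ((1 - l) * t + l * s) • K))
    (hK : μ K ≤ 1 / 2) :
    ∀ ε : ℝ, 0 < ε → ε < 1 →
      μ (ε • K) ≤ ENNReal.ofReal (ε ^ (2 * fK m)) * μ K ∧
      μ {x | gauge K x ≤ ε * m} ≤
        ENNReal.ofReal ((1 / 2) * ε ^ (2 * (m * fK m))) := by
  have h0int : (0 : EuclideanSpace ℝ (Fin n)) ∈ interior K := by
    obtain ⟨x, hx⟩ := hKint
    have hx' : -x ∈ interior K := by
      have h := (Homeomorph.neg (EuclideanSpace ℝ (Fin n))).preimage_interior K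
      have h2 : (Homeomorph.neg (EuclideanSpace ℝ (Fin n))) ⁻¹' K = K := hKsymm.symm
      rw [h2] at h
      rw [← h] at hx
      exact hx
    have := hKconv.interior hx hx' (show (0:ℝ) ≤ 1/2 by norm_num)
      (show (0:ℝ) ≤ 1/2 by norm_num) (by norm_num)
    simpa using this
  have hK0 : K ∈ nhds (0 : EuclideanSpace ℝ (Fin n)) := mem_interior_iff_mem_nhds.1 h0int
  have hcont := continuous_gauge hKconv hK0
  have hmeas : Measurable (gauge K) := hcont.measurable
  have hset : ∀ t : ℝ, 0 < t → t • K = {x | gauge K x ≤ t} := by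
    intro t ht
    ext x
    rw [mem_smul_set_iff_inv_smul_mem₀ ht.ne', ← hKc.isClosed.closure_eq,
      ← gauge_le_one_iff_mem_closure hKconv hK0, gauge_smul_of_nonneg (inv_nonneg.2 ht.le),
      hKc.isClosed.closure_eq, smul_eq_mul, inv_mul_le_iff₀ ht, mul_one]
    rfl
  have hatom : ∀ t : ℝ, μ {x | gauge K x = t} = 0 := by
    intro t
    have : μ.map (gauge K) {t} = 0 := by
      rw [hdens]
      exact withDensity_absolutelyContinuous _ _ (by simp)
    rw [Measure.map_apply hmeas (measurableSet_singleton t)] at this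
    exact this
  set F : ℝ → ℝ := fun t => (μ {x | gauge K x ≤ t}).toReal with hF
  have hmonoE : Monotone (fun t : ℝ => μ {x | gauge K x ≤ t}) := fun a b hab =>
    measure_mono (fun x (hx : gauge K x ≤ a) => (hx.trans hab : gauge K x ≤ b))
  have hmono : Monotone F := fun a b hab =>
    ENNReal.toReal_mono (measure_ne_top _ _) (hmonoE hab)
  have hm : 0 < m := by
    by_contra hle
    push Not at hle
    have h1 : μ {x | gauge K x ≤ m} ≤ μ {x | gauge K x = 0} :=
      measure_mono (fun x (hx : gauge K x ≤ m) =>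
        (le_antisymm (hx.trans hle) (gauge_nonneg x) : gauge K x = 0))
    rw [hatom 0] at h1
    have := hmed.trans h1
    norm_num at this
  have hFmE : μ {x | gauge K x ≤ m} = 1 / 2 := by
    refine le_antisymm ?_ hmed
    have hle : μ {x | gauge K x ≤ m} ≤ μ {x | gauge K x < m} := by
      calc μ {x | gauge K x ≤ m} ≤ μ ({x | gauge K x < m} ∪ {x | gauge K x = m}) :=
            measure_mono (fun x (hx : gauge K x ≤ m) => hx.lt_or_eq)
        _ ≤ _ := measure_union_le _ _
        _ = _ := by rw [hatom m, add_zero]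
    refine hle.trans ?_
    have hc : {x | gauge K x < m} = {x | m ≤ gauge K x}ᶜ := by
      ext x; simp
    rw [hc, prob_compl_eq_one_sub (measurableSet_le measurable_const hmeas)]
    refine (tsub_le_tsub_left hmed' 1).trans ?_
    simp
  have hlim : Filter.Tendsto F Filter.atTop (nhds 1) := by
    have h1 := tendsto_measure_Iic_atTop (μ.map (gauge K))
    rw [Measure.map_apply hmeas MeasurableSet.univ, preimage_univ, measure_univ] at h1
    have h2 := (ENNReal.tendsto_toReal ENNReal.one_ne_top).comp h1
    refine h2.congr (fun t => ?_)
    simp only [Function.comp, Measure.map_apply hmeas measurableSet_Iic]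
    rfl
  have hKeq : K = {x | gauge K x ≤ 1} := by
    have := hset 1 one_pos
    rwa [one_smul] at this
  have hKm : μ K = μ {x | gauge K x ≤ 1} := congrArg μ hKeq
  have hBF : ∀ t s l : ℝ, 0 < l → l < 1 →
      F (exp t) ^ (1 - l) * F (exp s) ^ l ≤ F (exp ((1 - l) * t + l * s)) := by
    intro t s l hl hl1
    have := ENNReal.toReal_mono (measure_ne_top _ _) (hB t s l hl hl1)
    rw [ENNReal.toReal_mul, ← ENNReal.toReal_rpow, ← ENNReal.toReal_rpow, hset _ (exp_pos _),
      hset _ (exp_pos _), hset _ (exp_pos _)] at this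
    exact this
  have hFm : F m = 1 / 2 := by
    simp only [hF, hFmE]; simp
  have hF1 : F 1 ≤ 1 / 2 := by
    rw [hKm] at hK
    have := ENNReal.toReal_mono (by simp) hK
    simpa [hF] using this
  intro ε h0 h1
  obtain ⟨a, b⟩ := core_aux F (fK m) m hmono (fun t => ENNReal.toReal_nonneg) hlim hBF hm hFm
    hderiv hF1 ε h0 h1
  constructor
  · rw [hset ε h0, hKm, ← ENNReal.ofReal_toReal (measure_ne_top μ {x | gauge K x ≤ ε}),
      ← ENNReal.ofReal_toReal (measure_ne_top μ {x | gauge K x ≤ 1}),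
      ← ENNReal.ofReal_mul (rpow_nonneg h0.le _)]
    exact ENNReal.ofReal_le_ofReal a
  · rw [← ENNReal.ofReal_toReal (measure_ne_top μ {x | gauge K x ≤ ε * m})]
    exact ENNReal.ofReal_le_ofReal b
end
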